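/- For the compound primitive relay channel with state set Q: if R < R_DF(Q), then there exist a > 0 and n₀ such that for every n ≥ n₀ there exists a (2^{nR}, n, e^{-an}) deterministic code; consequently the deterministic code capacity of the compound primitive relay channel is at least R_DF(Q). -/

import Mathlib

open scoped BigOperators ENNReal

noncomputable section

/-- `p` is a probability mass function on a finite type. -/
def IsPMF {α : Type} [Fintype α] (p : α → ℝ) : Prop :=
  (∀ a, 0 ≤ p a) ∧ ∑ a, p a = 1

/-- `W` is a channel: each `W x s` is a pmf on the output alphabet. -/
def IsChannel {𝒳 𝒮 𝒵 : Type} [Fintype 𝒵] (W : 𝒳 → 𝒮 → 𝒵 → ℝ) : Prop :=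
  ∀ x s, IsPMF (W x s)

/-- Shannon entropy (base 2). By the convention `log₂ 0 = 0` in Mathlib, terms with
`p a = 0` contribute `0`. -/
def ent {α : Type} [Fintype α] (p : α → ℝ) : ℝ :=
  -∑ a, p a * Real.logb 2 (p a)

/-- Mutual information of a joint pmf on a product of finite types. -/
def mutInfo {α β : Type} [Fintype α] [Fintype β] (p : α × β → ℝ) : ℝ :=
  ent (fun a => ∑ b, p (a, b)) + ent (fun b => ∑ a, p (a, b)) - ent p

/-- Conditional mutual information `I(X;Y|U)` of a joint pmf on `U × X × Y`,
via `I(X;Y|U) = H(U,X) + H(U,Y) − H(U,X,Y) − H(U)`. -/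
def condMutInfo {υ α β : Type} [Fintype υ] [Fintype α] [Fintype β]
    (p : υ × α × β → ℝ) : ℝ :=
  ent (fun ua : υ × α => ∑ b, p (ua.1, ua.2, b))
    + ent (fun ub : υ × β => ∑ a, p (ub.1, a, ub.2))
    - ent p
    - ent (fun u : υ => ∑ a, ∑ b, p (u, a, b))

section InfoQuantities

variable {𝒳 𝒮 𝒴 𝒴₁ : Type} [Fintype 𝒳] [Fintype 𝒮] [Fintype 𝒴] [Fintype 𝒴₁]

/-- `I_q(X;Y)` under input pmf `p(x)`, state pmf `q(s)` and channel `W`. -/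
def IqXY (W : 𝒳 → 𝒮 → 𝒴 × 𝒴₁ → ℝ) (p : 𝒳 → ℝ) (q : 𝒮 → ℝ) : ℝ :=
  mutInfo (fun xy : 𝒳 × 𝒴 => p xy.1 * ∑ s, q s * ∑ y1, W xy.1 s (xy.2, y1))

/-- `I_q(X;Y,Y₁)`. -/
def IqXYY1 (W : 𝒳 → 𝒮 → 𝒴 × 𝒴₁ → ℝ) (p : 𝒳 → ℝ) (q : 𝒮 → ℝ) : ℝ :=
  mutInfo (fun xz : 𝒳 × (𝒴 × 𝒴₁) => p xz.1 * ∑ s, q s * W xz.1 s xz.2)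

/-- `I_q(U;Y)` under input pmf `p(u,x)` (auxiliary alphabet `Fin k`). -/
def IqUY {k : ℕ} (W : 𝒳 → 𝒮 → 𝒴 × 𝒴₁ → ℝ) (p : Fin k × 𝒳 → ℝ) (q : 𝒮 → ℝ) : ℝ :=
  mutInfo (fun uy : Fin k × 𝒴 => ∑ x, ∑ s, ∑ y1, p (uy.1, x) * q s * W x s (uy.2, y1))

/-- `I_q(U;Y₁)` under input pmf `p(u,x)`. -/
def IqUY1 {k : ℕ} (W : 𝒳 → 𝒮 → 𝒴 × 𝒴₁ → ℝ) (p : Fin k × 𝒳 → ℝ) (q : 𝒮 → ℝ) : ℝ :=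
  mutInfo (fun uy : Fin k × 𝒴₁ => ∑ x, ∑ s, ∑ y, p (uy.1, x) * q s * W x s (y, uy.2))

/-- `I_q(X;Y|U)` under input pmf `p(u,x)`. -/
def IqXYgivenU {k : ℕ} (W : 𝒳 → 𝒮 → 𝒴 × 𝒴₁ → ℝ) (p : Fin k × 𝒳 → ℝ) (q : 𝒮 → ℝ) : ℝ :=
  condMutInfo (fun uxy : Fin k × 𝒳 × 𝒴 =>
    p (uxy.1, uxy.2.1) * ∑ s, q s * ∑ y1, W uxy.2.1 s (uxy.2.2, y1))

/-- The partial decode-forward lower bound `R_DF(Q)`: the supremum over all finite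
auxiliary alphabets (represented by `Fin k`) and input pmfs `p(u,x)` of
`min{ inf_q I_q(U;Y) + inf_q I_q(X;Y|U) + C₁, inf_q I_q(U;Y₁) + inf_q I_q(X;Y|U) }`. -/
def RDF (W : 𝒳 → 𝒮 → 𝒴 × 𝒴₁ → ℝ) (C1 : ℝ) (Q : Set (𝒮 → ℝ)) : ℝ :=
  sSup {r | ∃ (k : ℕ) (p : Fin k × 𝒳 → ℝ), IsPMF p ∧
    r = min
      (sInf {v | ∃ q ∈ Q, v = IqUY W p q} + sInf {v | ∃ q ∈ Q, v = IqXYgivenU W p q} + C1)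
      (sInf {v | ∃ q ∈ Q, v = IqUY1 W p q} + sInf {v | ∃ q ∈ Q, v = IqXYgivenU W p q})}

/-- The cutset upper bound
`R_CS(Q) = inf_{q∈Q} max_{p(x)} min{ I_q(X;Y) + C₁, I_q(X;Y,Y₁) }`. -/
def RCS (W : 𝒳 → 𝒮 → 𝒴 × 𝒴₁ → ℝ) (C1 : ℝ) (Q : Set (𝒮 → ℝ)) : ℝ :=
  sInf {r | ∃ q ∈ Q, r = sSup {v | ∃ p : 𝒳 → ℝ, IsPMF p ∧
    v = min (IqXY W p q + C1) (IqXYY1 W p q)}}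

end InfoQuantities

/-- A deterministic code for the primitive relay channel: a message encoder, a relay
function mapping the relay's received block to one of `L` indices sent over the
noiseless link, and a decoder using the channel output together with that index. -/
structure PCode (𝒳 𝒴 𝒴₁ : Type) (n M L : ℕ) where
  f : Fin M → Fin n → 𝒳
  f1 : (Fin n → 𝒴₁) → Fin L
  g : (Fin n → 𝒴) × Fin L → Fin M

/-- The noiseless link of rate `C₁` supports `L` indices when `L ≤ 2^{nC₁}`. -/
def LinkOK (n L : ℕ) (C1 : ℝ) : Prop := 1 ≤ L ∧ (L : ℝ) ≤ (2 : ℝ) ^ ((n : ℝ) * C1)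

section Codes

variable {𝒳 𝒮 𝒴 𝒴₁ : Type} [Fintype 𝒳] [Fintype 𝒮] [Fintype 𝒴] [Fintype 𝒴₁]
variable {n M L : ℕ}

/-- Conditional probability of error of the code given the state sequence `s`. -/
def PCode.errGiven (C : PCode 𝒳 𝒴 𝒴₁ n M L) (W : 𝒳 → 𝒮 → 𝒴 × 𝒴₁ → ℝ)
    (s : Fin n → 𝒮) : ℝ :=
  (M : ℝ)⁻¹ * ∑ m : Fin M, ∑ y : Fin n → 𝒴, ∑ y1 : Fin n → 𝒴₁,
    if C.g (y, C.f1 y1) = m then 0 else ∏ i, W (C.f m i) (s i) (y i, y1 i)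

/-- Average error probability under an i.i.d. state distribution `q`. -/
def PCode.errIID (C : PCode 𝒳 𝒴 𝒴₁ n M L) (W : 𝒳 → 𝒮 → 𝒴 × 𝒴₁ → ℝ)
    (q : 𝒮 → ℝ) : ℝ :=
  ∑ s : Fin n → 𝒮, (∏ i, q (s i)) * C.errGiven W s

/-- Average error probability under an arbitrary joint state distribution `qn`. -/
def PCode.errJoint (C : PCode 𝒳 𝒴 𝒴₁ n M L) (W : 𝒳 → 𝒮 → 𝒴 × 𝒴₁ → ℝ)
    (qn : (Fin n → 𝒮) → ℝ) : ℝ :=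
  ∑ s : Fin n → 𝒮, qn s * C.errGiven W s

end Codes

section Capacities

variable {𝒳 𝒮 𝒴 𝒴₁ : Type} [Fintype 𝒳] [Fintype 𝒮] [Fintype 𝒴] [Fintype 𝒴₁]

/-- `R` is achievable by deterministic codes over the compound primitive relay
channel with state set `Q`. -/
def CompAchievable (W : 𝒳 → 𝒮 → 𝒴 × 𝒴₁ → ℝ) (C1 : ℝ) (Q : Set (𝒮 → ℝ)) (R : ℝ) : Prop :=
  ∀ ε > (0 : ℝ), ∃ N : ℕ, ∀ n ≥ N, ∃ (M L : ℕ) (C : PCode 𝒳 𝒴 𝒴₁ n M L),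
    (2 : ℝ) ^ ((n : ℝ) * R) ≤ (M : ℝ) ∧ LinkOK n L C1 ∧
    ∀ q ∈ Q, C.errIID W q ≤ ε

/-- The deterministic code capacity of the compound primitive relay channel. -/
def CompCapacity (W : 𝒳 → 𝒮 → 𝒴 × 𝒴₁ → ℝ) (C1 : ℝ) (Q : Set (𝒮 → ℝ)) : ℝ :=
  sSup {R | CompAchievable W C1 Q R}

/-- `R` is achievable by random codes over the compound primitive relay channel. -/
def CompRandAchievable (W : 𝒳 → 𝒮 → 𝒴 × 𝒴₁ → ℝ) (C1 : ℝ) (Q : Set (𝒮 → ℝ)) (R : ℝ) :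
    Prop :=
  ∀ ε > (0 : ℝ), ∃ N : ℕ, ∀ n ≥ N, ∃ (M L : ℕ),
    (2 : ℝ) ^ ((n : ℝ) * R) ≤ (M : ℝ) ∧ LinkOK n L C1 ∧
    ∃ (J : Type) (π : PMF J) (Cs : J → PCode 𝒳 𝒴 𝒴₁ n M L),
      ∀ q ∈ Q, (∑' j, π j * ENNReal.ofReal ((Cs j).errIID W q)) ≤ ENNReal.ofReal ε

/-- The random code capacity of the compound primitive relay channel. -/
def CompRandCapacity (W : 𝒳 → 𝒮 → 𝒴 × 𝒴₁ → ℝ) (C1 : ℝ) (Q : Set (𝒮 → ℝ)) : ℝ :=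
  sSup {R | CompRandAchievable W C1 Q R}

/-- `R` is achievable by deterministic codes over the primitive AVRC: the average
error is small under every joint state distribution. -/
def AVRCAchievable (W : 𝒳 → 𝒮 → 𝒴 × 𝒴₁ → ℝ) (C1 R : ℝ) : Prop :=
  ∀ ε > (0 : ℝ), ∃ N : ℕ, ∀ n ≥ N, ∃ (M L : ℕ) (C : PCode 𝒳 𝒴 𝒴₁ n M L),
    (2 : ℝ) ^ ((n : ℝ) * R) ≤ (M : ℝ) ∧ LinkOK n L C1 ∧
    ∀ qn : (Fin n → 𝒮) → ℝ, IsPMF qn → C.errJoint W qn ≤ ε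

/-- The deterministic code capacity of the primitive AVRC. -/
def AVRCCapacity (W : 𝒳 → 𝒮 → 𝒴 × 𝒴₁ → ℝ) (C1 : ℝ) : ℝ :=
  sSup {R | AVRCAchievable W C1 R}

/-- `R` is achievable by random codes over the primitive AVRC. -/
def AVRCRandAchievable (W : 𝒳 → 𝒮 → 𝒴 × 𝒴₁ → ℝ) (C1 R : ℝ) : Prop :=
  ∀ ε > (0 : ℝ), ∃ N : ℕ, ∀ n ≥ N, ∃ (M L : ℕ),
    (2 : ℝ) ^ ((n : ℝ) * R) ≤ (M : ℝ) ∧ LinkOK n L C1 ∧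
    ∃ (J : Type) (π : PMF J) (Cs : J → PCode 𝒳 𝒴 𝒴₁ n M L),
      ∀ qn : (Fin n → 𝒮) → ℝ, IsPMF qn →
        (∑' j, π j * ENNReal.ofReal ((Cs j).errJoint W qn)) ≤ ENNReal.ofReal ε

/-- The random code capacity of the primitive AVRC. -/
def AVRCRandCapacity (W : 𝒳 → 𝒮 → 𝒴 × 𝒴₁ → ℝ) (C1 : ℝ) : ℝ :=
  sSup {R | AVRCRandAchievable W C1 R}

end Capacities

/-- The channel is reversely strongly degraded:
`W(y,y₁|x,s) = W_{Y|X,S}(y|x,s)·W_{Y₁|Y}(y₁|y)`. -/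
def RevStronglyDegraded {𝒳 𝒮 𝒴 𝒴₁ : Type} [Fintype 𝒴] [Fintype 𝒴₁]
    (W : 𝒳 → 𝒮 → 𝒴 × 𝒴₁ → ℝ) : Prop :=
  ∃ (WY : 𝒳 → 𝒮 → 𝒴 → ℝ) (V : 𝒴 → 𝒴₁ → ℝ),
    (∀ x s, IsPMF (WY x s)) ∧ (∀ y, IsPMF (V y)) ∧
    ∀ x s y y1, W x s (y, y1) = WY x s y * V y y1

/-- A state-dependent DMC `V(z|x,s)` is symmetrizable. -/
def Symmetrizable {𝒳 𝒮 𝒵 : Type} [Fintype 𝒮] (V : 𝒳 → 𝒮 → 𝒵 → ℝ) : Prop :=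
  ∃ J : 𝒳 → 𝒮 → ℝ, (∀ x, IsPMF (J x)) ∧
    ∀ x x' z, (∑ s, V x s z * J x' s) = ∑ s, V x' s z * J x s

lemma sum_prod_pi {ι α : Type} [Fintype ι] [DecidableEq ι] [Fintype α] (F : ι → α → ℝ) :
    ∑ a : ι → α, ∏ i, F i (a i) = ∏ i, ∑ a, F i a := by
  rw [Finset.prod_univ_sum, Fintype.piFinset_univ]

lemma marginal_one {ι β : Type} [Fintype ι] [DecidableEq ι] [Fintype β]
    (w : β → ℝ) (hw : ∑ b, w b = 1) (i₀ : ι) (F : β → ℝ) :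
    ∑ c : ι → β, (∏ i, w (c i)) * F (c i₀) = ∑ b, w b * F b := by
  have h := sum_prod_pi (fun i b => w b * if i = i₀ then F b else 1)
  simp only [Finset.prod_mul_distrib] at h
  rw [Finset.prod_eq_single i₀ (by intro i _ hi; simp [hi, hw]) (by simp)] at h
  simpa using h

lemma marginal_two {ι β : Type} [Fintype ι] [DecidableEq ι] [Fintype β]
    (w : β → ℝ) (hw : ∑ b, w b = 1) {i₀ i₁ : ι} (hne : i₀ ≠ i₁) (F : β → β → ℝ) :
    ∑ c : ι → β, (∏ i, w (c i)) * F (c i₀) (c i₁) = ∑ b, w b * ∑ b', w b' * F b b' := by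
  classical
  have key : ∀ b₀ : β, ∑ c : ι → β, (∏ i, w (c i)) * (if c i₀ = b₀ then F b₀ (c i₁) else 0)
      = w b₀ * ∑ b', w b' * F b₀ b' := by
    intro b₀
    have h := sum_prod_pi (fun i b => w b * ((if i = i₀ then (if b = b₀ then 1 else 0) else 1) *
      if i = i₁ then F b₀ b else 1))
    simp only [Finset.prod_mul_distrib] at h
    rw [Finset.prod_eq_mul i₀ i₁ hne (by intro i _ hi; simp [hi.1, hi.2, hw]) (by simp)
      (by simp)] at h
    simpa [hne, hne.symm] using h
  simp only [← key]
  rw [Finset.sum_comm]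
  refine Finset.sum_congr rfl fun c _ => ?_
  rw [← Finset.mul_sum]
  simp

/-- The probability of a superposition codebook: independent cloud centers drawn from `P`, and
around each center conditionally independent satellites drawn from `K`. -/
def bookWt {A B : Type} {M' M'' : ℕ} (P : A → ℝ) (K : A → B → ℝ)
    (c : Fin M' → A × (Fin M'' → B)) : ℝ :=
  ∏ m', (P (c m').1 * ∏ m'', K (c m').1 ((c m').2 m''))

section Codebook

variable {A B : Type} [Fintype A] [Fintype B] {M' M'' : ℕ} {P : A → ℝ} {K : A → B → ℝ}

lemma sum_cloudWt (hP : IsPMF P) (hK : ∀ u, IsPMF (K u)) :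
    ∑ b : A × (Fin M'' → B), P b.1 * ∏ m'', K b.1 (b.2 m'') = 1 := by
  rw [Fintype.sum_prod_type]
  simp only [← Finset.mul_sum]
  rw [← hP.2]
  refine Finset.sum_congr rfl fun u _ => ?_
  rw [sum_prod_pi (fun _ x => K u x)]
  simp [(hK u).2]

lemma bookWt_nonneg (hP : IsPMF P) (hK : ∀ u, IsPMF (K u)) (c : Fin M' → A × (Fin M'' → B)) :
    0 ≤ bookWt P K c :=
  Finset.prod_nonneg fun _ _ => mul_nonneg (hP.1 _) (Finset.prod_nonneg fun _ _ => (hK _).1 _)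

lemma sum_bookWt (hP : IsPMF P) (hK : ∀ u, IsPMF (K u)) :
    ∑ c : Fin M' → A × (Fin M'' → B), bookWt P K c = 1 := by
  unfold bookWt
  rw [sum_prod_pi (fun _ (b : A × (Fin M'' → B)) => P b.1 * ∏ m'', K b.1 (b.2 m''))]
  simp [sum_cloudWt hP hK]

lemma sum_bookWt_mul (hP : IsPMF P) (hK : ∀ u, IsPMF (K u)) (m' : Fin M') (m'' : Fin M'')
    (F : A → B → ℝ) :
    ∑ c : Fin M' → A × (Fin M'' → B), bookWt P K c * F (c m').1 ((c m').2 m'')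
      = ∑ u, ∑ x, P u * K u x * F u x := by
  unfold bookWt
  rw [marginal_one (fun b : A × (Fin M'' → B) => P b.1 * ∏ m'', K b.1 (b.2 m''))
    (sum_cloudWt hP hK) m' (fun b => F b.1 (b.2 m'')), Fintype.sum_prod_type]
  refine Finset.sum_congr rfl fun u _ => ?_
  simp only [mul_assoc, ← Finset.mul_sum]
  rw [marginal_one (K u) (hK u).2 m'' (F u)]

lemma sum_bookWt_mul_cloud (hP : IsPMF P) (hK : ∀ u, IsPMF (K u)) {m' l' : Fin M'}
    (hne : m' ≠ l') (m'' : Fin M'') (F : A → B → A → ℝ) :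
    ∑ c : Fin M' → A × (Fin M'' → B), bookWt P K c * F (c m').1 ((c m').2 m'') (c l').1
      = ∑ u, ∑ x, P u * K u x * ∑ v, P v * F u x v := by
  unfold bookWt
  rw [marginal_two (fun b : A × (Fin M'' → B) => P b.1 * ∏ m'', K b.1 (b.2 m''))
    (sum_cloudWt hP hK) hne (fun b b' => F b.1 (b.2 m'') b'.1), Fintype.sum_prod_type]
  refine Finset.sum_congr rfl fun u _ => ?_
  simp only [mul_assoc, ← Finset.mul_sum]
  rw [← marginal_one (K u) (hK u).2 m'' (fun x => ∑ v, P v * F u x v)]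
  congr 1
  refine Finset.sum_congr rfl fun x _ => ?_
  congr 1
  rw [Fintype.sum_prod_type]
  refine Finset.sum_congr rfl fun v _ => ?_
  simp only [← Finset.mul_sum, ← Finset.sum_mul]
  rw [sum_prod_pi (fun _ x => K v x)]
  simp [(hK v).2]

lemma sum_bookWt_mul_satellite (hP : IsPMF P) (hK : ∀ u, IsPMF (K u)) (m' : Fin M')
    {m'' l'' : Fin M''} (hne : m'' ≠ l'') (F : A → B → B → ℝ) :
    ∑ c : Fin M' → A × (Fin M'' → B),
        bookWt P K c * F (c m').1 ((c m').2 m'') ((c m').2 l'')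
      = ∑ u, ∑ x, P u * K u x * ∑ v, K u v * F u x v := by
  unfold bookWt
  rw [marginal_one (fun b : A × (Fin M'' → B) => P b.1 * ∏ m'', K b.1 (b.2 m''))
    (sum_cloudWt hP hK) m' (fun b => F b.1 (b.2 m'') (b.2 l'')), Fintype.sum_prod_type]
  refine Finset.sum_congr rfl fun u _ => ?_
  simp only [mul_assoc, ← Finset.mul_sum]
  rw [marginal_two (K u) (hK u).2 hne (F u)]

end Codebook

lemma exists_binning (M L : ℕ) (hL : 0 < L) :
    ∃ bin : Fin M → Fin L, ∀ m,
      (((Finset.univ.filter fun l => l ≠ m ∧ bin l = bin m).card : ℕ) : ℝ)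
        ≤ ((M : ℝ) - 1) / L := by
  refine ⟨fun m => ⟨m % L, Nat.mod_lt _ hL⟩, fun m => ?_⟩
  set S := Finset.univ.filter fun l : Fin M => l ≠ m ∧
    (⟨l % L, Nat.mod_lt _ hL⟩ : Fin L) = ⟨m % L, Nat.mod_lt _ hL⟩ with hS
  have hcard : S.card ≤ ((Finset.range ((M - 1) / L + 1)).erase (m / L)).card := by
    refine Finset.card_le_card_of_injOn (fun l : Fin M => (l : ℕ) / L) ?_ ?_
    · intro l hl
      simp only [hS, Finset.coe_filter, Finset.mem_univ, true_and, Set.mem_ofPred_eq,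
        Fin.mk.injEq] at hl
      have h1 := Nat.div_add_mod (l : ℕ) L
      have h2 := Nat.div_add_mod (m : ℕ) L
      simp only [Finset.coe_erase, Set.mem_sdiff, Finset.mem_coe, Finset.mem_range,
        Set.mem_singleton_iff]
      refine ⟨Nat.lt_succ_of_le (Nat.div_le_div_right (by omega)), fun h => hl.1 ?_⟩
      apply Fin.ext
      rw [← h1, ← h2, h, hl.2]
    · intro l hl l' hl' h
      simp only [hS, Finset.coe_filter, Finset.mem_univ, true_and, Set.mem_ofPred_eq,
        Fin.mk.injEq] at hl hl'
      have h1 := Nat.div_add_mod (l : ℕ) L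
      have h2 := Nat.div_add_mod (l' : ℕ) L
      apply Fin.ext
      simp only at h
      rw [← h1, ← h2, h, hl.2, hl'.2]
  rw [Finset.card_erase_of_mem (by
    simp only [Finset.mem_range]
    exact Nat.lt_succ_of_le (Nat.div_le_div_right (by omega))), Finset.card_range,
    Nat.add_sub_cancel] at hcard
  have hM : 1 ≤ M := by have := m.2; omega
  calc (S.card : ℝ) ≤ ((M - 1) / L : ℕ) := by exact_mod_cast hcard
    _ ≤ ((M - 1 : ℕ) : ℝ) / L := Nat.cast_div_le
    _ = ((M : ℝ) - 1) / L := by rw [Nat.cast_sub hM, Nat.cast_one]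

section OneShot

variable {A B D D₁ J : Type} [Fintype A] [Fintype B] [Fintype D] [Fintype D₁] [Fintype J]
  {P : A → ℝ} {K : A → B → ℝ}

lemma false_accept_le (hP : IsPMF P) (hK : ∀ u, IsPMF (K u)) {V : Type} [Fintype V]
    {G : B → D → D₁ → ℝ} (hG : ∀ x y z, 0 ≤ G x y z) {μ δ : ℝ} (hδ : 0 ≤ δ)
    (hμ : ∀ x, ∑ y, ∑ z, G x y z ≤ μ) (w : A → V → ℝ) (I : A → V → D → D₁ → ℝ)
    (hI : ∀ u y z, ∑ v, w u v * I u v y z ≤ δ) :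
    ∑ u, ∑ x, P u * K u x * ∑ v, w u v * ∑ y, ∑ z, G x y z * I u v y z ≤ μ * δ := by
  have h1 : ∀ u x, ∑ v, w u v * ∑ y, ∑ z, G x y z * I u v y z ≤ μ * δ := by
    intro u x
    calc ∑ v, w u v * ∑ y, ∑ z, G x y z * I u v y z
        = ∑ y, ∑ z, G x y z * ∑ v, w u v * I u v y z := by
          simp only [Finset.mul_sum]
          rw [Finset.sum_comm]
          refine Finset.sum_congr rfl fun y _ => ?_
          rw [Finset.sum_comm]
          refine Finset.sum_congr rfl fun z _ => Finset.sum_congr rfl fun v _ => by ring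
      _ ≤ ∑ y, ∑ z, G x y z * δ := by
          gcongr with y _ z _
          · exact hG _ _ _
          · exact hI _ _ _
      _ = (∑ y, ∑ z, G x y z) * δ := by simp only [Finset.sum_mul]
      _ ≤ μ * δ := by gcongr; exact hμ x
  calc _ ≤ ∑ u, ∑ x, P u * K u x * (μ * δ) := by
        gcongr with u _ x _
        · exact mul_nonneg (hP.1 u) ((hK u).1 x)
        · exact h1 u x
    _ = μ * δ := by
        simp only [← Finset.sum_mul, ← Finset.mul_sum, (hK _).2, mul_one, hP.2, one_mul]

lemma exists_le_of_weighted_sum_le {Γ : Type} [Fintype Γ] {w E : Γ → ℝ} {b : ℝ}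
    (h0 : ∀ c, 0 ≤ w c) (h1 : ∑ c, w c = 1) (h : ∑ c, w c * E c ≤ b) : ∃ c, E c ≤ b := by
  by_contra! hc
  have h2 : ∑ c, w c * (E c - b) ≤ 0 := by
    simp only [mul_sub, Finset.sum_sub_distrib, ← Finset.sum_mul, h1]
    linarith
  have h3 : ∀ c ∈ Finset.univ, 0 ≤ w c * (E c - b) := fun c _ =>
    mul_nonneg (h0 c) (sub_nonneg.2 (hc c).le)
  have h4 := (Finset.sum_eq_zero_iff_of_nonneg h3).1 (le_antisymm h2 (Finset.sum_nonneg h3))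
  have h5 : ∀ c, w c = 0 := fun c => by
    rcases mul_eq_zero.1 (h4 c (Finset.mem_univ c)) with h | h
    · exact h
    · linarith [hc c]
  simp [h5] at h1

open Classical in
set_option maxHeartbeats 1000000 in
lemma exists_oneShot_code (hP : IsPMF P) (hK : ∀ u, IsPMF (K u))
    {G : J → B → D → D₁ → ℝ} (hG : ∀ j x y z, 0 ≤ G j x y z) {μ : ℝ}
    (hμ : ∀ j x, ∑ y, ∑ z, G j x y z ≤ μ)
    (T₁ : A → D₁ → Prop) (T₂ : A → D → Prop) (T₃ : A → B → D → Prop) {e δ₁ δ₂ δ₃ : ℝ}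
    (hδ₁ : 0 ≤ δ₁) (hδ₂ : 0 ≤ δ₂) (hδ₃ : 0 ≤ δ₃) (hμ0 : 0 ≤ μ)
    (miss₁ : ∀ j, ∑ u, ∑ x, P u * K u x *
      ∑ y, ∑ z, G j x y z * (if T₁ u z then 0 else 1) ≤ e)
    (miss₂ : ∀ j, ∑ u, ∑ x, P u * K u x *
      ∑ y, ∑ z, G j x y z * (if T₂ u y then 0 else 1) ≤ e)
    (miss₃ : ∀ j, ∑ u, ∑ x, P u * K u x *
      ∑ y, ∑ z, G j x y z * (if T₃ u x y then 0 else 1) ≤ e)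
    (false₁ : ∀ z, ∑ v, P v * (if T₁ v z then 1 else 0) ≤ δ₁)
    (false₂ : ∀ y, ∑ v, P v * (if T₂ v y then 1 else 0) ≤ δ₂)
    (false₃ : ∀ u y, ∑ v, K u v * (if T₃ u v y then 1 else 0) ≤ δ₃)
    {M' M'' L : ℕ} (hM' : 0 < M') (hM'' : 0 < M'') (hL : 0 < L) :
    ∃ (f : Fin M' × Fin M'' → B) (f₁ : D₁ → Fin L) (g : D × Fin L → Fin M' × Fin M''),
      ∀ j, ∑ m, ∑ y, ∑ z, (if g (y, f₁ z) = m then 0 else G j (f m) y z) ≤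
        (M' * M'' : ℝ) * (Fintype.card J * (3 * e +
          μ * ((M' - 1) * δ₁ + (M' - 1) / L * δ₂ + (M'' - 1) * δ₃))) := by
  obtain ⟨bin, hbin⟩ := exists_binning M' L hL
  have : Nonempty (Fin M') := ⟨⟨0, hM'⟩⟩
  have : Nonempty (Fin M'') := ⟨⟨0, hM''⟩⟩
  let Γ := Fin M' → A × (Fin M'' → B)
  let relay : Γ → D₁ → Fin M' := fun c z => Classical.epsilon fun m' => T₁ (c m').1 z
  let dec : Γ → D × Fin L → Fin M' × Fin M'' := fun c yl => Classical.epsilon fun m =>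
    bin m.1 = yl.2 ∧ T₂ (c m.1).1 yl.1 ∧ T₃ (c m.1).1 ((c m.1).2 m.2) yl.1
  let err : Γ → J → Fin M' × Fin M'' → ℝ := fun c j m =>
    ∑ y, ∑ z, (if dec c (y, bin (relay c z)) = m then 0 else G j ((c m.1).2 m.2) y z)
  let S : Fin M' → Finset (Fin M') := fun m => Finset.univ.filter fun l => l ≠ m ∧ bin l = bin m
  have correct : ∀ (c : Γ) (m : Fin M' × Fin M'') (y : D) (z : D₁),
      T₁ (c m.1).1 z → T₂ (c m.1).1 y → T₃ (c m.1).1 ((c m.1).2 m.2) y →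
      (∀ l ≠ m.1, ¬ T₁ (c l).1 z) → (∀ l ∈ S m.1, ¬ T₂ (c l).1 y) →
      (∀ l ≠ m.2, ¬ T₃ (c m.1).1 ((c m.1).2 l) y) → dec c (y, bin (relay c z)) = m := by
    intro c m y z h1 h2 h3 h4 h5 h6
    have hr : relay c z = m.1 := by
      have := Classical.epsilon_spec (p := fun m' => T₁ (c m').1 z) ⟨m.1, h1⟩
      by_contra hne
      exact h4 _ hne this
    have hd := Classical.epsilon_spec (p := fun m₀ : Fin M' × Fin M'' =>
      bin m₀.1 = bin (relay c z) ∧ T₂ (c m₀.1).1 y ∧ T₃ (c m₀.1).1 ((c m₀.1).2 m₀.2) y)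
      ⟨m, by rw [hr], h2, h3⟩
    change bin (dec c (y, bin (relay c z))).1 = _ ∧ T₂ (c (dec c (y, bin (relay c z))).1).1 y ∧
      T₃ (c (dec c (y, bin (relay c z))).1).1 ((c (dec c (y, bin (relay c z))).1).2
        (dec c (y, bin (relay c z))).2) y at hd
    generalize dec c (y, bin (relay c z)) = d at hd ⊢
    obtain ⟨hd1, hd2, hd3⟩ := hd
    rw [hr] at hd1
    have e1 : d.1 = m.1 := by
      by_contra hne
      exact h5 d.1 (by simp [S, hne, hd1]) hd2
    have e2 : d.2 = m.2 := by
      by_contra hne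
      rw [e1] at hd3
      exact h6 _ hne hd3
    exact Prod.ext e1 e2
  let F₁ : J → A → B → ℝ := fun j u x => ∑ y, ∑ z, G j x y z * (if T₁ u z then 0 else 1)
  let F₂ : J → A → B → ℝ := fun j u x => ∑ y, ∑ z, G j x y z * (if T₂ u y then 0 else 1)
  let F₃ : J → A → B → ℝ := fun j u x => ∑ y, ∑ z, G j x y z * (if T₃ u x y then 0 else 1)
  let H₁ : J → A → B → A → ℝ := fun j _ x v => ∑ y, ∑ z, G j x y z * (if T₁ v z then 1 else 0)
  let H₂ : J → A → B → A → ℝ := fun j _ x v => ∑ y, ∑ z, G j x y z * (if T₂ v y then 1 else 0)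
  let H₃ : J → A → B → B → ℝ := fun j u x v => ∑ y, ∑ z, G j x y z * (if T₃ u v y then 1 else 0)
  have err_le : ∀ c j m, err c j m ≤
      F₁ j (c m.1).1 ((c m.1).2 m.2) + F₂ j (c m.1).1 ((c m.1).2 m.2)
      + F₃ j (c m.1).1 ((c m.1).2 m.2)
      + ∑ l ∈ Finset.univ.erase m.1, H₁ j (c m.1).1 ((c m.1).2 m.2) (c l).1
      + ∑ l ∈ S m.1, H₂ j (c m.1).1 ((c m.1).2 m.2) (c l).1
      + ∑ l ∈ Finset.univ.erase m.2, H₃ j (c m.1).1 ((c m.1).2 m.2) ((c m.1).2 l) := by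
    intro c j m
    have hcomm : ∀ {I : Type} (s : Finset I) (Φ : I → D → D₁ → ℝ),
        ∑ l ∈ s, ∑ y, ∑ z, Φ l y z = ∑ y, ∑ z, ∑ l ∈ s, Φ l y z := by
      intro I s Φ
      rw [Finset.sum_comm]
      exact Finset.sum_congr rfl fun y _ => Finset.sum_comm
    simp only [F₁, F₂, F₃, H₁, H₂, H₃, hcomm, ← Finset.sum_add_distrib, err, ← Finset.mul_sum,
      ← mul_add]
    refine Finset.sum_le_sum fun y _ => Finset.sum_le_sum fun z _ => ?_
    have hg := hG j ((c m.1).2 m.2) y z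
    have n1 : (0 : ℝ) ≤ if T₁ (c m.1).1 z then 0 else 1 := by split_ifs <;> norm_num
    have n2 : (0 : ℝ) ≤ if T₂ (c m.1).1 y then 0 else 1 := by split_ifs <;> norm_num
    have n3 : (0 : ℝ) ≤ if T₃ (c m.1).1 ((c m.1).2 m.2) y then 0 else 1 := by
      split_ifs <;> norm_num
    have p4 : ∀ l ∈ Finset.univ.erase m.1, (0 : ℝ) ≤ if T₁ (c l).1 z then 1 else 0 := by
      intro l _; split_ifs <;> norm_num
    have p5 : ∀ l ∈ S m.1, (0 : ℝ) ≤ if T₂ (c l).1 y then 1 else 0 := by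
      intro l _; split_ifs <;> norm_num
    have p6 : ∀ l ∈ Finset.univ.erase m.2,
        (0 : ℝ) ≤ if T₃ (c m.1).1 ((c m.1).2 l) y then 1 else 0 := by
      intro l _; split_ifs <;> norm_num
    have n4 := Finset.sum_nonneg p4
    have n5 := Finset.sum_nonneg p5
    have n6 := Finset.sum_nonneg p6
    split_ifs at * with hd
    all_goals first
      | exact mul_nonneg hg (by linarith)
      | skip
    all_goals
      refine le_mul_of_one_le_right hg ?_
      first
        | linarith
        | skip
    by_contra hlt
    push Not at hlt
    apply hd
    refine correct c m y z ‹_› ‹_› ‹_› ?_ ?_ ?_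
    · intro l hl ht
      have := Finset.single_le_sum p4 (Finset.mem_erase.2 ⟨hl, Finset.mem_univ l⟩)
      rw [if_pos ht] at this
      linarith
    · intro l hl ht
      have := Finset.single_le_sum p5 hl
      rw [if_pos ht] at this
      linarith
    · intro l hl ht
      have := Finset.single_le_sum p6 (Finset.mem_erase.2 ⟨hl, Finset.mem_univ l⟩)
      rw [if_pos ht] at this
      linarith
  set bd : ℝ := 3 * e + μ * ((M' - 1) * δ₁ + (M' - 1) / L * δ₂ + (M'' - 1) * δ₃) with hbd
  have mean_le : ∀ j m, ∑ c : Γ, bookWt P K c * err c j m ≤ bd := by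
    intro j m
    have f₁ : ∀ l, m.1 ≠ l → ∑ c : Γ, bookWt P K c *
        H₁ j (c m.1).1 ((c m.1).2 m.2) (c l).1 ≤ μ * δ₁ := by
      intro l hl
      rw [sum_bookWt_mul_cloud hP hK hl m.2 (H₁ j)]
      exact false_accept_le hP hK (hG j) hδ₁ (hμ j) (fun _ v => P v)
        (fun _ v _ z => if T₁ v z then 1 else 0) (fun _ _ z => false₁ z)
    have f₂ : ∀ l, m.1 ≠ l → ∑ c : Γ, bookWt P K c *
        H₂ j (c m.1).1 ((c m.1).2 m.2) (c l).1 ≤ μ * δ₂ := by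
      intro l hl
      rw [sum_bookWt_mul_cloud hP hK hl m.2 (H₂ j)]
      exact false_accept_le hP hK (hG j) hδ₂ (hμ j) (fun _ v => P v)
        (fun _ v y _ => if T₂ v y then 1 else 0) (fun _ y _ => false₂ y)
    have f₃ : ∀ l, m.2 ≠ l → ∑ c : Γ, bookWt P K c *
        H₃ j (c m.1).1 ((c m.1).2 m.2) ((c m.1).2 l) ≤ μ * δ₃ := by
      intro l hl
      rw [sum_bookWt_mul_satellite hP hK m.1 hl (H₃ j)]
      exact false_accept_le hP hK (hG j) hδ₃ (hμ j) (fun u v => K u v)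
        (fun u v y _ => if T₃ u v y then 1 else 0) (fun u y _ => false₃ u y)
    calc ∑ c : Γ, bookWt P K c * err c j m
        ≤ ∑ c : Γ, bookWt P K c * (F₁ j (c m.1).1 ((c m.1).2 m.2)
            + F₂ j (c m.1).1 ((c m.1).2 m.2) + F₃ j (c m.1).1 ((c m.1).2 m.2)
            + ∑ l ∈ Finset.univ.erase m.1, H₁ j (c m.1).1 ((c m.1).2 m.2) (c l).1
            + ∑ l ∈ S m.1, H₂ j (c m.1).1 ((c m.1).2 m.2) (c l).1
            + ∑ l ∈ Finset.univ.erase m.2, H₃ j (c m.1).1 ((c m.1).2 m.2) ((c m.1).2 l)) :=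
          Finset.sum_le_sum fun c _ =>
            mul_le_mul_of_nonneg_left (err_le c j m) (bookWt_nonneg hP hK c)
      _ = ∑ u, ∑ x, P u * K u x * F₁ j u x + ∑ u, ∑ x, P u * K u x * F₂ j u x
          + ∑ u, ∑ x, P u * K u x * F₃ j u x
          + ∑ l ∈ Finset.univ.erase m.1, ∑ c : Γ, bookWt P K c *
              H₁ j (c m.1).1 ((c m.1).2 m.2) (c l).1
          + ∑ l ∈ S m.1, ∑ c : Γ, bookWt P K c * H₂ j (c m.1).1 ((c m.1).2 m.2) (c l).1
          + ∑ l ∈ Finset.univ.erase m.2, ∑ c : Γ, bookWt P K c *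
              H₃ j (c m.1).1 ((c m.1).2 m.2) ((c m.1).2 l) := by
          simp only [mul_add, Finset.sum_add_distrib, Finset.mul_sum (Finset.univ.erase _),
            Finset.mul_sum (S _)]
          rw [sum_bookWt_mul hP hK m.1 m.2 (F₁ j), sum_bookWt_mul hP hK m.1 m.2 (F₂ j),
            sum_bookWt_mul hP hK m.1 m.2 (F₃ j)]
          simp only [Finset.sum_comm (s := (Finset.univ : Finset Γ))]
      _ ≤ e + e + e + ∑ l ∈ Finset.univ.erase m.1, μ * δ₁ + ∑ l ∈ S m.1, μ * δ₂
          + ∑ l ∈ Finset.univ.erase m.2, μ * δ₃ := by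
          gcongr with l hl l hl l hl
          · exact miss₁ j
          · exact miss₂ j
          · exact miss₃ j
          · exact f₁ l (Finset.ne_of_mem_erase hl).symm
          · exact f₂ l (by simpa [S] using fun h => (Finset.mem_filter.1 hl).2.1 h.symm)
          · exact f₃ l (Finset.ne_of_mem_erase hl).symm
      _ ≤ bd := by
          have c1 : (((Finset.univ.erase m.1).card : ℕ) : ℝ) = M' - 1 := by
            rw [Finset.card_erase_of_mem (Finset.mem_univ _), Finset.card_univ, Fintype.card_fin,
              Nat.cast_sub hM', Nat.cast_one]
          have c2 : (((Finset.univ.erase m.2).card : ℕ) : ℝ) = M'' - 1 := by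
            rw [Finset.card_erase_of_mem (Finset.mem_univ _), Finset.card_univ, Fintype.card_fin,
              Nat.cast_sub hM'', Nat.cast_one]
          have c3 : ((S m.1).card : ℝ) ≤ (M' - 1) / L := hbin m.1
          simp only [Finset.sum_const, nsmul_eq_mul, c1, c2]
          have := mul_le_mul_of_nonneg_right c3 (mul_nonneg hμ0 hδ₂)
          rw [hbd]
          linarith
  have total : ∑ c : Γ, bookWt P K c * ∑ j, ∑ m, err c j m
      ≤ (M' * M'' : ℝ) * (Fintype.card J * bd) := by
    calc ∑ c : Γ, bookWt P K c * ∑ j, ∑ m, err c j m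
        = ∑ j, ∑ m, ∑ c : Γ, bookWt P K c * err c j m := by
          simp only [Finset.mul_sum]
          rw [Finset.sum_comm]
          exact Finset.sum_congr rfl fun j _ => Finset.sum_comm
      _ ≤ ∑ j : J, ∑ m : Fin M' × Fin M'', bd :=
          Finset.sum_le_sum fun j _ => Finset.sum_le_sum fun m _ => mean_le j m
      _ = _ := by simp; ring
  obtain ⟨c, hc⟩ := exists_le_of_weighted_sum_le (bookWt_nonneg hP hK) (sum_bookWt hP hK) total
  refine ⟨fun m => (c m.1).2 m.2, fun z => bin (relay c z), dec c, fun j => ?_⟩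
  have herr0 : ∀ j m, 0 ≤ err c j m := fun j m => Finset.sum_nonneg fun y _ =>
    Finset.sum_nonneg fun z _ => by split_ifs; exacts [le_rfl, hG _ _ _ _]
  have hj : ∑ m, err c j m ≤ ∑ j, ∑ m, err c j m :=
    Finset.single_le_sum (f := fun j => ∑ m, err c j m)
      (fun j _ => Finset.sum_nonneg fun m _ => herr0 j m) (Finset.mem_univ j)
  refine le_trans (le_of_eq ?_) (hj.trans hc)
  refine Finset.sum_congr rfl fun m _ => Finset.sum_congr rfl fun y _ =>
    Finset.sum_congr rfl fun z _ => ?_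
  congr

end OneShot

section Information

lemma mutInfo_eq_sum {α β : Type} [Fintype α] [Fintype β] {P : α × β → ℝ} (hP : ∀ a, 0 ≤ P a) :
    mutInfo P = ∑ a, ∑ b, P (a, b) *
      Real.logb 2 (P (a, b) / ((∑ b', P (a, b')) * ∑ a', P (a', b))) := by
  have h : ∀ a b, P (a, b) * Real.logb 2 (P (a, b) / ((∑ b', P (a, b')) * ∑ a', P (a', b)))
      = P (a, b) * Real.logb 2 (P (a, b)) - P (a, b) * Real.logb 2 (∑ b', P (a, b'))
        - P (a, b) * Real.logb 2 (∑ a', P (a', b)) := by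
    intro a b
    rcases (hP (a, b)).eq_or_lt with h0 | h0
    · simp [← h0]
    · have h1 : 0 < ∑ b', P (a, b') := h0.trans_le
        (Finset.single_le_sum (f := fun b' => P (a, b')) (fun _ _ => hP _) (Finset.mem_univ b))
      have h2 : 0 < ∑ a', P (a', b) := h0.trans_le
        (Finset.single_le_sum (f := fun a' => P (a', b)) (fun _ _ => hP _) (Finset.mem_univ a))
      rw [Real.logb_div h0.ne' (mul_pos h1 h2).ne', Real.logb_mul h1.ne' h2.ne']
      ring
  simp only [h, Finset.sum_sub_distrib]
  rw [Finset.sum_comm (f := fun a b => P (a, b) * Real.logb 2 (∑ a', P (a', b)))]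
  simp only [mutInfo, ent, ← Finset.sum_mul, Fintype.sum_prod_type]
  ring

lemma condMutInfo_eq_sum {υ α β : Type} [Fintype υ] [Fintype α] [Fintype β]
    {P : υ × α × β → ℝ} (hP : ∀ a, 0 ≤ P a) :
    condMutInfo P = ∑ u, ∑ a, ∑ b, P (u, a, b) *
      Real.logb 2 (P (u, a, b) * (∑ a', ∑ b', P (u, a', b')) /
        ((∑ b', P (u, a, b')) * ∑ a', P (u, a', b))) := by
  have h : ∀ u a b, P (u, a, b) * Real.logb 2 (P (u, a, b) * (∑ a', ∑ b', P (u, a', b')) /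
        ((∑ b', P (u, a, b')) * ∑ a', P (u, a', b)))
      = P (u, a, b) * Real.logb 2 (P (u, a, b))
        + P (u, a, b) * Real.logb 2 (∑ a', ∑ b', P (u, a', b'))
        - P (u, a, b) * Real.logb 2 (∑ b', P (u, a, b'))
        - P (u, a, b) * Real.logb 2 (∑ a', P (u, a', b)) := by
    intro u a b
    rcases (hP (u, a, b)).eq_or_lt with h0 | h0
    · simp [← h0]
    · have h1 : 0 < ∑ b', P (u, a, b') := h0.trans_le
        (Finset.single_le_sum (f := fun b' => P (u, a, b')) (fun _ _ => hP _) (Finset.mem_univ b))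
      have h2 : 0 < ∑ a', P (u, a', b) := h0.trans_le
        (Finset.single_le_sum (f := fun a' => P (u, a', b)) (fun _ _ => hP _) (Finset.mem_univ a))
      have h3 : 0 < ∑ a', ∑ b', P (u, a', b') := h1.trans_le
        (Finset.single_le_sum (f := fun a' => ∑ b', P (u, a', b'))
          (fun _ _ => Finset.sum_nonneg fun _ _ => hP _) (Finset.mem_univ a))
      rw [Real.logb_div (mul_pos h0 h3).ne' (mul_pos h1 h2).ne', Real.logb_mul h1.ne' h2.ne',
        Real.logb_mul h0.ne' h3.ne']
      ring
  simp only [h, Finset.sum_sub_distrib, Finset.sum_add_distrib]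
  simp only [Finset.sum_comm (s := (Finset.univ : Finset α)) (t := (Finset.univ : Finset β))
    (f := fun a b => P (_, a, b) * Real.logb 2 (∑ a', P (_, a', b)))]
  simp only [condMutInfo, ent, ← Finset.sum_mul, Fintype.sum_prod_type]
  ring

lemma continuous_ent {α : Type} [Fintype α] : Continuous (ent : (α → ℝ) → ℝ) := by
  have : (ent : (α → ℝ) → ℝ) = fun p => -∑ a, (p a * Real.log (p a)) / Real.log 2 := by
    funext p
    simp only [ent, Real.logb, mul_div_assoc]
  rw [this]
  refine (continuous_finsetSum _ fun a _ => ?_).neg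
  exact (Real.continuous_mul_log.comp (continuous_apply a)).div_const _

variable {𝒳 𝒮 𝒴 𝒴₁ : Type} [Fintype 𝒳] [Fintype 𝒮] [Fintype 𝒴] [Fintype 𝒴₁]

lemma continuous_IqUY {k : ℕ} (W : 𝒳 → 𝒮 → 𝒴 × 𝒴₁ → ℝ) (p : Fin k × 𝒳 → ℝ) :
    Continuous (IqUY W p) := by
  unfold IqUY mutInfo
  refine ((continuous_ent.comp ?_).add (continuous_ent.comp ?_)).sub (continuous_ent.comp ?_)
  all_goals fun_prop

lemma continuous_IqUY1 {k : ℕ} (W : 𝒳 → 𝒮 → 𝒴 × 𝒴₁ → ℝ) (p : Fin k × 𝒳 → ℝ) :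
    Continuous (IqUY1 W p) := by
  unfold IqUY1 mutInfo
  refine ((continuous_ent.comp ?_).add (continuous_ent.comp ?_)).sub (continuous_ent.comp ?_)
  all_goals fun_prop

lemma continuous_IqXYgivenU {k : ℕ} (W : 𝒳 → 𝒮 → 𝒴 × 𝒴₁ → ℝ) (p : Fin k × 𝒳 → ℝ) :
    Continuous (IqXYgivenU W p) := by
  unfold IqXYgivenU condMutInfo
  refine (((continuous_ent.comp ?_).add (continuous_ent.comp ?_)).sub
    (continuous_ent.comp ?_)).sub (continuous_ent.comp ?_)
  all_goals fun_prop

end Information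

section Tilting

lemma exists_chernoff {A : Type} [Fintype A] {P : A → ℝ} (hP : IsPMF P) (g : A → ℝ)
    (hg : 0 < ∑ a, P a * g a) : ∃ t : ℝ, 0 ≤ t ∧ ∑ a, P a * Real.exp (-(t * g a)) < 1 := by
  have hd : HasDerivAt (fun t : ℝ => ∑ a, P a * Real.exp (-(t * g a)))
      (∑ a, P a * (Real.exp (-(0 * g a)) * -(1 * g a))) 0 := by
    refine HasDerivAt.fun_sum fun a _ => ?_
    exact ((((hasDerivAt_id (0 : ℝ)).mul_const (g a)).neg).exp).const_mul (P a)
  have hneg : ∑ a, P a * (Real.exp (-(0 * g a)) * -(1 * g a)) < 0 := by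
    simp only [zero_mul, neg_zero, Real.exp_zero, one_mul, mul_neg, Finset.sum_neg_distrib]
    linarith
  have h0 : ∑ a, P a * Real.exp (-((0 : ℝ) * g a)) = 1 := by simp [hP.2]
  have hs := (hasDerivAt_iff_tendsto_slope_zero.1 hd).mono_left
    (nhdsWithin_mono (0 : ℝ) (s := Set.Ioi 0) (fun x hx => ne_of_gt hx))
  obtain ⟨t, ht, htpos⟩ := ((hs.eventually (gt_mem_nhds hneg)).and self_mem_nhdsWithin).exists
  have htpos' : (0 : ℝ) < t := htpos
  refine ⟨t, htpos'.le, ?_⟩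
  simp only [zero_add, h0, smul_eq_mul] at ht
  have := (mul_neg_iff.1 ht).resolve_right (fun h => absurd h.1 (not_lt.2 (by positivity)))
  linarith [this.2]

/-- A likelihood ratio mixed with a small constant still certifies any rate below the mean
log-likelihood, with an exponential tail bound. -/
lemma exists_tilt {A : Type} [Fintype A] {P : A → ℝ} (hP : IsPMF P) {R : A → ℝ}
    (hR : ∀ a, 0 ≤ R a) (hPR : ∀ a, 0 < P a → 0 < R a) {γ : ℝ}
    (hγ : γ < ∑ a, P a * Real.logb 2 (R a)) :
    ∃ η t : ℝ, 0 < η ∧ η < 1 ∧ 0 ≤ t ∧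
      ∑ a, P a * ((2 : ℝ) ^ γ / ((1 - η) * R a + η)) ^ t < 1 := by
  set Δ := ∑ a, P a * Real.logb 2 (R a) - γ with hΔ
  have hΔ0 : 0 < Δ := sub_pos.2 hγ
  set ζ : ℝ := (2 : ℝ) ^ (-(Δ / 2)) with hζ
  have hζ0 : 0 < ζ := by positivity
  have hζ1 : ζ < 1 := Real.rpow_lt_one_of_one_lt_of_neg one_lt_two (by linarith)
  have hpos : ∀ a, 0 < (1 - (1 - ζ)) * R a + (1 - ζ) := fun a => by
    have := mul_nonneg hζ0.le (hR a)
    linarith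
  have hmean : γ < ∑ a, P a * Real.logb 2 ((1 - (1 - ζ)) * R a + (1 - ζ)) := by
    calc γ < ∑ a, P a * Real.logb 2 (R a) + -(Δ / 2) := by linarith
      _ = ∑ a, P a * (Real.logb 2 (R a) + -(Δ / 2)) := by
          simp only [mul_add, Finset.sum_add_distrib, ← Finset.sum_mul, hP.2, one_mul]
      _ ≤ _ := by
          refine Finset.sum_le_sum fun a _ => ?_
          rcases (hP.1 a).eq_or_lt with h | h
          · simp [← h]
          refine mul_le_mul_of_nonneg_left ?_ h.le
          have hlog : -(Δ / 2) = Real.logb 2 ζ := by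
            rw [hζ, Real.logb_rpow two_pos (by norm_num)]
          rw [hlog, ← Real.logb_mul (hPR a h).ne' hζ0.ne']
          refine Real.logb_le_logb_of_le one_lt_two (mul_pos (hPR a h) hζ0) ?_
          nlinarith
  obtain ⟨t, ht0, ht⟩ := exists_chernoff hP
    (fun a => Real.log 2 * (Real.logb 2 ((1 - (1 - ζ)) * R a + (1 - ζ)) - γ)) (by
      have e : ∑ a, P a * (Real.log 2 * (Real.logb 2 ((1 - (1 - ζ)) * R a + (1 - ζ)) - γ))
          = Real.log 2 * (∑ a, P a * Real.logb 2 ((1 - (1 - ζ)) * R a + (1 - ζ)) - γ) := by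
        have : ∑ a, P a * γ = γ := by rw [← Finset.sum_mul, hP.2, one_mul]
        conv_rhs => rw [← this]
        rw [← Finset.sum_sub_distrib, Finset.mul_sum]
        exact Finset.sum_congr rfl fun a _ => by ring
      rw [e]
      exact mul_pos (Real.log_pos one_lt_two) (sub_pos.2 hmean))
  refine ⟨1 - ζ, t, by linarith, by linarith, ht0, ?_⟩
  convert ht using 3 with a
  have hl : Real.log 2 ≠ 0 := (Real.log_pos one_lt_two).ne'
  rw [Real.rpow_def_of_pos (div_pos (by positivity) (hpos a)),
    Real.log_div (by positivity) (hpos a).ne', Real.log_rpow two_pos, Real.logb]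
  congr 1
  field_simp
  ring

lemma sum_mul_ratio_le_one {α β : Type} [Fintype α] [Fintype β] {P : α × β → ℝ}
    (hP : ∀ a, 0 ≤ P a) (b : β) :
    ∑ a, (∑ b', P (a, b')) * (P (a, b) / ((∑ b', P (a, b')) * ∑ a', P (a', b))) ≤ 1 := by
  calc _ ≤ ∑ a, P (a, b) / ∑ a', P (a', b) := by
        refine Finset.sum_le_sum fun a _ => ?_
        rcases (Finset.sum_nonneg fun b' _ => hP (a, b') :
          0 ≤ ∑ b', P (a, b')).eq_or_lt with h | h
        · rw [← h, zero_mul]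
          exact div_nonneg (hP _) (Finset.sum_nonneg fun _ _ => hP _)
        · rw [← mul_div_assoc, mul_div_mul_left _ _ h.ne']
    _ ≤ 1 := by
        rw [← Finset.sum_div]
        exact div_self_le_one _

lemma sum_mul_mix_le_one {α : Type} [Fintype α] {w r : α → ℝ} (hw : ∑ a, w a = 1)
    (hr : ∑ a, w a * r a ≤ 1) {η : ℝ} (h1 : η < 1) :
    ∑ a, w a * ((1 - η) * r a + η) ≤ 1 := by
  have : ∑ a, w a * ((1 - η) * r a + η) = (1 - η) * ∑ a, w a * r a + η := by
    have h : ∀ a, w a * ((1 - η) * r a + η) = (1 - η) * (w a * r a) + w a * η := fun a => by ring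
    simp only [h, Finset.sum_add_distrib, ← Finset.mul_sum, ← Finset.sum_mul, hw, one_mul]
  rw [this]
  nlinarith

end Tilting

section SingleLetter

variable {𝒳 𝒮 𝒴 𝒴₁ : Type} [Fintype 𝒳] [Fintype 𝒮] [Fintype 𝒴] [Fintype 𝒴₁]

/-- The channel `W` averaged over a state weight `q`. -/
def avgChannel (W : 𝒳 → 𝒮 → 𝒴 × 𝒴₁ → ℝ) (q : 𝒮 → ℝ) (x : 𝒳) (z : 𝒴 × 𝒴₁) : ℝ :=
  ∑ s, q s * W x s z

omit [Fintype 𝒳] in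
lemma avgChannel_nonneg {W : 𝒳 → 𝒮 → 𝒴 × 𝒴₁ → ℝ} (hW : IsChannel W) {q : 𝒮 → ℝ}
    (hq : ∀ s, 0 ≤ q s) (x : 𝒳) (z : 𝒴 × 𝒴₁) : 0 ≤ avgChannel W q x z :=
  Finset.sum_nonneg fun s _ => mul_nonneg (hq s) ((hW x s).1 z)

omit [Fintype 𝒳] in
lemma sum_avgChannel {W : 𝒳 → 𝒮 → 𝒴 × 𝒴₁ → ℝ} (hW : IsChannel W) (q : 𝒮 → ℝ) (x : 𝒳) :
    ∑ z, avgChannel W q x z = ∑ s, q s := by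
  unfold avgChannel
  rw [Finset.sum_comm]
  simp [← Finset.mul_sum, (hW x _).2]

/-- The joint weight of auxiliary letter, input and outputs. -/
def jointWt {υ : Type} (p : υ × 𝒳 → ℝ) (V : 𝒳 → 𝒴 × 𝒴₁ → ℝ) (a : υ × 𝒳 × 𝒴 × 𝒴₁) : ℝ :=
  p (a.1, a.2.1) * V a.2.1 a.2.2

lemma isPMF_jointWt {υ : Type} [Fintype υ] {p : υ × 𝒳 → ℝ} (hp : IsPMF p)
    {W : 𝒳 → 𝒮 → 𝒴 × 𝒴₁ → ℝ} (hW : IsChannel W) {q : 𝒮 → ℝ} (hq : IsPMF q) :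
    IsPMF (jointWt p (avgChannel W q)) := by
  refine ⟨fun a => mul_nonneg (hp.1 _) (avgChannel_nonneg hW hq.1 _ _), ?_⟩
  rw [← hp.2, Fintype.sum_prod_type, Fintype.sum_prod_type]
  refine Finset.sum_congr rfl fun u _ => ?_
  rw [Fintype.sum_prod_type]
  refine Finset.sum_congr rfl fun x _ => ?_
  simp only [jointWt, ← Finset.mul_sum, sum_avgChannel hW, hq.2, mul_one]

/-- The moment controlling the probability that the true codeword fails a test at level `b`. -/
def missMoment {υ : Type} [Fintype υ] (p : υ × 𝒳 → ℝ) (V : 𝒳 → 𝒴 × 𝒴₁ → ℝ)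
    (ρ : υ → 𝒳 → 𝒴 → 𝒴₁ → ℝ) (b t : ℝ) : ℝ :=
  ∑ u, ∑ x, ∑ y, ∑ z, p (u, x) * V x (y, z) * (b / ρ u x y z) ^ t

lemma missMoment_eq {υ : Type} [Fintype υ] (p : υ × 𝒳 → ℝ) (V : 𝒳 → 𝒴 × 𝒴₁ → ℝ)
    (ρ : υ → 𝒳 → 𝒴 → 𝒴₁ → ℝ) (b t : ℝ) :
    missMoment p V ρ b t = ∑ a, jointWt p V a * (b / ρ a.1 a.2.1 a.2.2.1 a.2.2.2) ^ t := by
  simp only [missMoment, Fintype.sum_prod_type, jointWt]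

variable {k : ℕ} {p : Fin k × 𝒳 → ℝ} {W : 𝒳 → 𝒮 → 𝒴 × 𝒴₁ → ℝ} {q : 𝒮 → ℝ} {γ : ℝ}

lemma exists_test_UY1 (hp : IsPMF p) (hW : IsChannel W) (hq : IsPMF q) (hγ : γ < IqUY1 W p q) :
    ∃ (ρ : Fin k → 𝒴₁ → ℝ) (t : ℝ), (∀ u z, 0 < ρ u z) ∧ 0 ≤ t ∧
      (∀ z, ∑ u, (∑ x, p (u, x)) * ρ u z ≤ 1) ∧
      missMoment p (avgChannel W q) (fun u _ _ z => ρ u z) ((2 : ℝ) ^ γ) t < 1 := by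
  set Pj : Fin k × 𝒴₁ → ℝ :=
    fun uy => ∑ x, ∑ s, ∑ y, p (uy.1, x) * q s * W x s (y, uy.2) with hPj
  have hP0 : ∀ a, 0 ≤ Pj a := fun a => Finset.sum_nonneg fun x _ => Finset.sum_nonneg fun s _ =>
    Finset.sum_nonneg fun y _ => mul_nonneg (mul_nonneg (hp.1 _) (hq.1 _)) ((hW x s).1 _)
  have hPj' : ∀ u z, Pj (u, z) = ∑ x, ∑ y, jointWt p (avgChannel W q) (u, x, y, z) := by
    intro u z
    simp only [hPj, jointWt, avgChannel, Finset.mul_sum]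
    refine Finset.sum_congr rfl fun x _ => ?_
    rw [Finset.sum_comm]
    exact Finset.sum_congr rfl fun _ _ => Finset.sum_congr rfl fun _ _ => by ring
  have hmarg : ∀ u, ∑ z, Pj (u, z) = ∑ x, p (u, x) := by
    intro u
    simp only [hPj']
    rw [Finset.sum_comm]
    refine Finset.sum_congr rfl fun x _ => ?_
    have := sum_avgChannel hW q x
    rw [Fintype.sum_prod_type, hq.2, Finset.sum_comm] at this
    simp only [jointWt, ← Finset.mul_sum, this, mul_one]
  set R : Fin k → 𝒴₁ → ℝ := fun u z => Pj (u, z) / ((∑ z', Pj (u, z')) * ∑ u', Pj (u', z))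
    with hR
  have hjoint := isPMF_jointWt hp hW hq
  have hR0 : ∀ u z, 0 ≤ R u z := fun u z => div_nonneg (hP0 _) (mul_nonneg
    (Finset.sum_nonneg fun _ _ => hP0 _) (Finset.sum_nonneg fun _ _ => hP0 _))
  obtain ⟨η, t, hη0, hη1, ht, hlt⟩ := exists_tilt (γ := γ) hjoint
    (R := fun a => R a.1 a.2.2.2) (fun a => hR0 _ _) (by
      rintro ⟨u, x, y, z⟩ ha
      have h0 : 0 < Pj (u, z) := by
        rw [hPj']
        refine ha.trans_le (le_trans ?_ (Finset.single_le_sum (fun x _ => Finset.sum_nonneg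
          fun y _ => hjoint.1 _) (Finset.mem_univ x)))
        exact Finset.single_le_sum (f := fun y => jointWt p (avgChannel W q) (u, x, y, z))
          (fun y _ => hjoint.1 _) (Finset.mem_univ y)
      exact div_pos h0 (mul_pos
        (h0.trans_le (Finset.single_le_sum (f := fun z' => Pj (u, z')) (fun _ _ => hP0 _)
          (Finset.mem_univ z)))
        (h0.trans_le (Finset.single_le_sum (f := fun u' => Pj (u', z)) (fun _ _ => hP0 _)
          (Finset.mem_univ u))))) (by
      refine hγ.trans_eq ?_
      have : IqUY1 W p q = mutInfo Pj := rfl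
      rw [this, mutInfo_eq_sum hP0, Fintype.sum_prod_type]
      refine Finset.sum_congr rfl fun u _ => ?_
      simp only [Fintype.sum_prod_type]
      change ∑ z, Pj (u, z) * Real.logb 2 (R u z) = _
      have e : ∀ z, Pj (u, z) * Real.logb 2 (R u z) = ∑ x, ∑ y,
          jointWt p (avgChannel W q) (u, x, y, z) * Real.logb 2 (R u z) := by
        intro z
        rw [hPj', Finset.sum_mul]
        exact Finset.sum_congr rfl fun x _ => Finset.sum_mul ..
      simp only [e]
      rw [Finset.sum_comm]
      exact Finset.sum_congr rfl fun x _ => Finset.sum_comm)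
  refine ⟨fun u z => (1 - η) * R u z + η, t, fun u z => ?_, ht, fun z => ?_, ?_⟩
  · have := mul_nonneg (sub_nonneg.2 hη1.le) (hR0 u z)
    linarith
  · refine sum_mul_mix_le_one ?_ ?_ hη1
    · rw [← hp.2, Fintype.sum_prod_type]
    · simp only [← hmarg]
      exact sum_mul_ratio_le_one hP0 z
  · rw [missMoment_eq]
    exact hlt

lemma exists_test_UY (hp : IsPMF p) (hW : IsChannel W) (hq : IsPMF q) (hγ : γ < IqUY W p q) :
    ∃ (ρ : Fin k → 𝒴 → ℝ) (t : ℝ), (∀ u y, 0 < ρ u y) ∧ 0 ≤ t ∧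
      (∀ y, ∑ u, (∑ x, p (u, x)) * ρ u y ≤ 1) ∧
      missMoment p (avgChannel W q) (fun u _ y _ => ρ u y) ((2 : ℝ) ^ γ) t < 1 := by
  have hW' : IsChannel (fun x s (z : 𝒴₁ × 𝒴) => W x s z.swap) := fun x s =>
    ⟨fun z => (hW x s).1 _, by rw [← (hW x s).2]; exact (Equiv.prodComm 𝒴₁ 𝒴).sum_comp (W x s)⟩
  obtain ⟨ρ, t, hρ, ht, h1, h2⟩ := exists_test_UY1 (γ := γ) hp hW' hq hγ
  refine ⟨ρ, t, hρ, ht, h1, lt_of_eq_of_lt ?_ h2⟩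
  unfold missMoment
  exact Finset.sum_congr rfl fun u _ => Finset.sum_congr rfl fun x _ => Finset.sum_comm

lemma exists_test_XYgivenU (hp : IsPMF p) {pU : Fin k → ℝ} {κ : Fin k → 𝒳 → ℝ}
    (hκ : ∀ u, IsPMF (κ u)) (hpκ : ∀ u x, p (u, x) = pU u * κ u x)
    (hW : IsChannel W) (hq : IsPMF q) (hγ : γ < IqXYgivenU W p q) :
    ∃ (ρ : Fin k → 𝒳 → 𝒴 → ℝ) (t : ℝ), (∀ u x y, 0 < ρ u x y) ∧ 0 ≤ t ∧
      (∀ u y, ∑ x, κ u x * ρ u x y ≤ 1) ∧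
      missMoment p (avgChannel W q) (fun u x y _ => ρ u x y) ((2 : ℝ) ^ γ) t < 1 := by
  set Pj : Fin k × 𝒳 × 𝒴 → ℝ :=
    fun a => p (a.1, a.2.1) * ∑ s, q s * ∑ y1, W a.2.1 s (a.2.2, y1) with hPj
  have hPj' : ∀ u x y, Pj (u, x, y) = ∑ z, jointWt p (avgChannel W q) (u, x, y, z) := by
    intro u x y
    simp only [hPj, jointWt, avgChannel, Finset.mul_sum]
    rw [Finset.sum_comm]
  have hjoint := isPMF_jointWt hp hW hq
  have hP0 : ∀ a, 0 ≤ Pj a := by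
    rintro ⟨u, x, y⟩
    rw [hPj']
    exact Finset.sum_nonneg fun _ _ => hjoint.1 _
  have hUX : ∀ u x, ∑ y, Pj (u, x, y) = pU u * κ u x := by
    intro u x
    have := sum_avgChannel hW q x
    rw [Fintype.sum_prod_type, hq.2] at this
    simp only [hPj', jointWt, ← Finset.mul_sum, this, mul_one, hpκ]
  have hU : ∀ u, ∑ x, ∑ y, Pj (u, x, y) = pU u := by
    intro u
    simp only [hUX, ← Finset.mul_sum, (hκ u).2, mul_one]
  set R : Fin k → 𝒳 → 𝒴 → ℝ := fun u x y => Pj (u, x, y) * (∑ x', ∑ y', Pj (u, x', y')) /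
    ((∑ y', Pj (u, x, y')) * ∑ x', Pj (u, x', y)) with hR
  have hR0 : ∀ u x y, 0 ≤ R u x y := fun u x y => div_nonneg
    (mul_nonneg (hP0 _) (Finset.sum_nonneg fun _ _ => Finset.sum_nonneg fun _ _ => hP0 _))
    (mul_nonneg (Finset.sum_nonneg fun _ _ => hP0 _) (Finset.sum_nonneg fun _ _ => hP0 _))
  obtain ⟨η, t, hη0, hη1, ht, hlt⟩ := exists_tilt (γ := γ) hjoint
    (R := fun a => R a.1 a.2.1 a.2.2.1) (fun a => hR0 _ _ _) (by
      rintro ⟨u, x, y, z⟩ ha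
      have h0 : 0 < Pj (u, x, y) := by
        rw [hPj']
        exact ha.trans_le (Finset.single_le_sum
          (f := fun z => jointWt p (avgChannel W q) (u, x, y, z))
          (fun y _ => hjoint.1 _) (Finset.mem_univ z))
      have h1 : 0 < ∑ y', Pj (u, x, y') := h0.trans_le (Finset.single_le_sum
        (f := fun y' => Pj (u, x, y')) (fun _ _ => hP0 _) (Finset.mem_univ y))
      have h2 : 0 < ∑ x', Pj (u, x', y) := h0.trans_le (Finset.single_le_sum
        (f := fun x' => Pj (u, x', y)) (fun _ _ => hP0 _) (Finset.mem_univ x))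
      have h3 : 0 < ∑ x', ∑ y', Pj (u, x', y') := h1.trans_le (Finset.single_le_sum
        (f := fun x' => ∑ y', Pj (u, x', y')) (fun _ _ => Finset.sum_nonneg fun _ _ => hP0 _)
        (Finset.mem_univ x))
      exact div_pos (mul_pos h0 h3) (mul_pos h1 h2)) (by
      refine hγ.trans_eq ?_
      have : IqXYgivenU W p q = condMutInfo Pj := rfl
      rw [this, condMutInfo_eq_sum hP0]
      simp only [Fintype.sum_prod_type]
      refine Finset.sum_congr rfl fun u _ => Finset.sum_congr rfl fun x _ =>
        Finset.sum_congr rfl fun y _ => ?_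
      change Pj (u, x, y) * Real.logb 2 (R u x y) = _
      rw [hPj', Finset.sum_mul])
  refine ⟨fun u x y => (1 - η) * R u x y + η, t, fun u x y => ?_, ht, fun u y => ?_, ?_⟩
  · have := mul_nonneg (sub_nonneg.2 hη1.le) (hR0 u x y)
    linarith
  · refine sum_mul_mix_le_one (hκ u).2 ?_ hη1
    calc ∑ x, κ u x * R u x y ≤ ∑ x, Pj (u, x, y) / ∑ x', Pj (u, x', y) := by
          refine Finset.sum_le_sum fun x _ => ?_
          simp only [hR]
          rw [hU, hUX]
          by_cases h : pU u * κ u x = 0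
          · rw [h, zero_mul, div_zero, mul_zero]
            exact div_nonneg (hP0 _) (Finset.sum_nonneg fun _ _ => hP0 _)
          · rw [← mul_div_assoc, show κ u x * (Pj (u, x, y) * pU u) =
              (pU u * κ u x) * Pj (u, x, y) by ring, mul_div_mul_left _ _ h]
      _ ≤ 1 := by
          rw [← Finset.sum_div]
          exact div_self_le_one _
  · rw [missMoment_eq]
    exact hlt

end SingleLetter

section Cover

variable {𝒳 𝒮 𝒴 𝒴₁ : Type} [Fintype 𝒳] [Fintype 𝒮] [Fintype 𝒴] [Fintype 𝒴₁]

/-- Single-letter scores for the three decoding tests of a superposition code (cloud center at the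
relay, cloud center at the receiver, satellite at the receiver), with tilting exponents. Each score
has mean at most one on an independent codeword. -/
structure ScoreTriple {υ : Type} [Fintype υ] (𝒴 𝒴₁ : Type) (pU : υ → ℝ) (κ : υ → 𝒳 → ℝ) where
  relay : υ → 𝒴₁ → ℝ
  cloud : υ → 𝒴 → ℝ
  satellite : υ → 𝒳 → 𝒴 → ℝ
  relayExp : ℝ
  cloudExp : ℝ
  satelliteExp : ℝ
  relay_pos : ∀ u z, 0 < relay u z
  cloud_pos : ∀ u y, 0 < cloud u y
  satellite_pos : ∀ u x y, 0 < satellite u x y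
  relayExp_nonneg : 0 ≤ relayExp
  cloudExp_nonneg : 0 ≤ cloudExp
  satelliteExp_nonneg : 0 ≤ satelliteExp
  relay_mean : ∀ z, ∑ u, pU u * relay u z ≤ 1
  cloud_mean : ∀ y, ∑ u, pU u * cloud u y ≤ 1
  satellite_mean : ∀ u y, ∑ x, κ u x * satellite u x y ≤ 1

/-- All three tests at thresholds `b₁`, `b₂`, `b₃` have miss moments at most `θ`. -/
def ScoreTriple.MissLE {υ : Type} [Fintype υ] {pU : υ → ℝ} {κ : υ → 𝒳 → ℝ}
    (τ : ScoreTriple 𝒴 𝒴₁ pU κ) (p : υ × 𝒳 → ℝ) (V : 𝒳 → 𝒴 × 𝒴₁ → ℝ) (b₁ b₂ b₃ θ : ℝ) : Prop :=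
  missMoment p V (fun u _ _ z => τ.relay u z) b₁ τ.relayExp ≤ θ ∧
  missMoment p V (fun u _ y _ => τ.cloud u y) b₂ τ.cloudExp ≤ θ ∧
  missMoment p V (fun u x y _ => τ.satellite u x y) b₃ τ.satelliteExp ≤ θ

lemma continuous_missMoment {υ : Type} [Fintype υ] (p : υ × 𝒳 → ℝ) (W : 𝒳 → 𝒮 → 𝒴 × 𝒴₁ → ℝ)
    (q : 𝒮 → ℝ) (ρ : υ → 𝒳 → 𝒴 → 𝒴₁ → ℝ) (b t : ℝ) :
    Continuous fun ε : ℝ => missMoment p (avgChannel W fun s => q s + ε) ρ b t := by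
  unfold missMoment avgChannel
  fun_prop

lemma isPMF_of_mem_closure {Q : Set (𝒮 → ℝ)} (hQ : ∀ q ∈ Q, IsPMF q) {q : 𝒮 → ℝ}
    (hq : q ∈ closure Q) : IsPMF q := by
  have h : closure Q ⊆ stdSimplex ℝ 𝒮 :=
    closure_minimal (fun q hq => hQ q hq) (isClosed_stdSimplex ℝ 𝒮)
  exact h hq

lemma isCompact_closure_of_isPMF {Q : Set (𝒮 → ℝ)} (hQ : ∀ q ∈ Q, IsPMF q) :
    IsCompact (closure Q) :=
  (isCompact_stdSimplex ℝ 𝒮).of_isClosed_subset isClosed_closure fun _ hq =>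
    isPMF_of_mem_closure hQ hq

variable {k : ℕ} {p : Fin k × 𝒳 → ℝ} {W : 𝒳 → 𝒮 → 𝒴 × 𝒴₁ → ℝ} {γ₁ γ₂ γ₃ : ℝ}
  {pU : Fin k → ℝ} {κ : Fin k → 𝒳 → ℝ}

lemma exists_local_scores (hp : IsPMF p) (hpU : ∀ u, ∑ x, p (u, x) = pU u)
    (hκ : ∀ u, IsPMF (κ u)) (hpκ : ∀ u x, p (u, x) = pU u * κ u x)
    (hW : IsChannel W) {q : 𝒮 → ℝ} (hq : IsPMF q) {μ : ℝ} (hμ : 1 < μ)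
    (h₁ : γ₁ < IqUY1 W p q) (h₂ : γ₂ < IqUY W p q) (h₃ : γ₃ < IqXYgivenU W p q) :
    ∃ (τ : ScoreTriple 𝒴 𝒴₁ pU κ) (ε θ : ℝ), 0 < ε ∧ 0 ≤ θ ∧ θ < 1 ∧ ∑ s, (q s + ε) ≤ μ ∧
      τ.MissLE p (avgChannel W fun s => q s + ε) ((2 : ℝ) ^ γ₁) ((2 : ℝ) ^ γ₂) ((2 : ℝ) ^ γ₃) θ := by
  obtain ⟨ρ₁, t₁, hρ₁, ht₁, hm₁, hl₁⟩ := exists_test_UY1 hp hW hq h₁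
  obtain ⟨ρ₂, t₂, hρ₂, ht₂, hm₂, hl₂⟩ := exists_test_UY hp hW hq h₂
  obtain ⟨ρ₃, t₃, hρ₃, ht₃, hm₃, hl₃⟩ := exists_test_XYgivenU hp hκ hpκ hW hq h₃
  simp only [hpU] at hm₁ hm₂
  have hev : ∀ (F : ℝ → ℝ) (c : ℝ), Continuous F → F 0 < c →
      ∀ᶠ ε in nhdsWithin (0 : ℝ) (Set.Ioi 0), F ε < c := fun F c hF h0 =>
    (hF.continuousAt.eventually_lt continuousAt_const h0).filter_mono nhdsWithin_le_nhds
  have e₁ := hev _ 1 (continuous_missMoment p W q (fun u _ _ z => ρ₁ u z) ((2 : ℝ) ^ γ₁) t₁)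
    (by simpa using hl₁)
  have e₂ := hev _ 1 (continuous_missMoment p W q (fun u _ y _ => ρ₂ u y) ((2 : ℝ) ^ γ₂) t₂)
    (by simpa using hl₂)
  have e₃ := hev _ 1 (continuous_missMoment p W q (fun u x y _ => ρ₃ u x y) ((2 : ℝ) ^ γ₃) t₃)
    (by simpa using hl₃)
  have e₄ := hev (fun ε => ∑ s, (q s + ε)) μ (by fun_prop) (by simpa [hq.2] using hμ)
  obtain ⟨ε, ⟨⟨⟨hε₁, hε₂⟩, hε₃⟩, hε₄⟩, hε⟩ :=
    ((((e₁.and e₂).and e₃).and e₄).and self_mem_nhdsWithin).exists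
  refine ⟨⟨ρ₁, ρ₂, ρ₃, t₁, t₂, t₃, hρ₁, hρ₂, hρ₃, ht₁, ht₂, ht₃, hm₁, hm₂, hm₃⟩, ε, _, hε,
    le_max_left 0 (max (missMoment p (avgChannel W fun s => q s + ε) (fun u _ _ z => ρ₁ u z) _ t₁)
      (max (missMoment p (avgChannel W fun s => q s + ε) (fun u _ y _ => ρ₂ u y) _ t₂)
      (missMoment p (avgChannel W fun s => q s + ε) (fun u x y _ => ρ₃ u x y) _ t₃))),
    max_lt one_pos (max_lt hε₁ (max_lt hε₂ hε₃)), hε₄.le, ?_, ?_, ?_⟩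
  · simp
  · simp
  · simp

lemma exists_score_cover (hp : IsPMF p) (hpU : ∀ u, ∑ x, p (u, x) = pU u)
    (hκ : ∀ u, IsPMF (κ u)) (hpκ : ∀ u x, p (u, x) = pU u * κ u x)
    (hW : IsChannel W) {Q : Set (𝒮 → ℝ)} (hQ : ∀ q ∈ Q, IsPMF q) {μ : ℝ} (hμ : 1 < μ)
    (h₁ : ∀ q ∈ closure Q, γ₁ < IqUY1 W p q) (h₂ : ∀ q ∈ closure Q, γ₂ < IqUY W p q)
    (h₃ : ∀ q ∈ closure Q, γ₃ < IqXYgivenU W p q) :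
    ∃ (J : Type) (_ : Fintype J) (ν : J → 𝒮 → ℝ) (τ : J → ScoreTriple 𝒴 𝒴₁ pU κ) (θ : ℝ),
      0 ≤ θ ∧ θ < 1 ∧ (∀ j s, 0 ≤ ν j s) ∧ (∀ j, ∑ s, ν j s ≤ μ) ∧
      (∀ q ∈ Q, ∃ j, ∀ s, q s ≤ ν j s) ∧
      ∀ j, (τ j).MissLE p (avgChannel W (ν j)) ((2 : ℝ) ^ γ₁) ((2 : ℝ) ^ γ₂) ((2 : ℝ) ^ γ₃) θ := by
  have hloc := fun q (hq : q ∈ closure Q) => exists_local_scores hp hpU hκ hpκ hW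
    (isPMF_of_mem_closure hQ hq) hμ (h₁ q hq) (h₂ q hq) (h₃ q hq)
  choose τ ε θ hε hθ0 hθ1 hmass hmiss using hloc
  obtain ⟨T, hT⟩ := (isCompact_closure_of_isPMF hQ).elim_nhds_subcover'
    (fun q hq => {r | ∀ s, r s < q s + ε q hq}) (fun q hq => by
      have : IsOpen {r : 𝒮 → ℝ | ∀ s, r s < q s + ε q hq} := by
        simp only [Set.ofPred_forall]
        exact isOpen_iInter_of_finite fun s => isOpen_lt (continuous_apply s) continuous_const
      exact this.mem_nhds fun s => by linarith [hε q hq])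
  obtain ⟨Θ, hΘ0, hΘ1, hΘ⟩ : ∃ Θ : ℝ, 0 ≤ Θ ∧ Θ < 1 ∧ ∀ j : T, θ j.1.1 j.1.2 ≤ Θ := by
    rcases isEmpty_or_nonempty T with h | h
    · exact ⟨0, le_rfl, one_pos, fun j => h.elim j⟩
    · obtain ⟨j₀, hj₀⟩ := Finite.exists_max fun j : T => θ j.1.1 j.1.2
      exact ⟨_, hθ0 _ _, hθ1 _ _, hj₀⟩
  refine ⟨T, inferInstance, fun j s => j.1.1 s + ε j.1.1 j.1.2, fun j => τ j.1.1 j.1.2, Θ,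
    hΘ0, hΘ1, fun j s => ?_, fun j => hmass _ _, fun q hq => ?_, fun j => ?_⟩
  · have := (isPMF_of_mem_closure hQ j.1.2).1 s
    linarith [hε j.1.1 j.1.2]
  · obtain ⟨j, hj, hqj⟩ := Set.mem_iUnion₂.1 (hT (subset_closure hq))
    exact ⟨⟨j, hj⟩, fun s => (hqj s).le⟩
  · obtain ⟨a, b, c⟩ := hmiss j.1.1 j.1.2
    exact ⟨a.trans (hΘ j), b.trans (hΘ j), c.trans (hΘ j)⟩

end Cover

section Block

variable {𝒳 𝒮 𝒴 𝒴₁ : Type} [Fintype 𝒳] [Fintype 𝒮] [Fintype 𝒴] [Fintype 𝒴₁]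

omit [Fintype 𝒳] in
lemma errIID_eq {n M L : ℕ} (C : PCode 𝒳 𝒴 𝒴₁ n M L) (W : 𝒳 → 𝒮 → 𝒴 × 𝒴₁ → ℝ) (q : 𝒮 → ℝ) :
    C.errIID W q = (M : ℝ)⁻¹ * ∑ m : Fin M, ∑ y : Fin n → 𝒴, ∑ z : Fin n → 𝒴₁,
      if C.g (y, C.f1 z) = m then 0 else ∏ i, avgChannel W q (C.f m i) (y i, z i) := by
  have h : ∀ (x : Fin n → 𝒳) (y : Fin n → 𝒴) (z : Fin n → 𝒴₁),
      ∏ i, avgChannel W q (x i) (y i, z i)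
        = ∑ s : Fin n → 𝒮, (∏ i, q (s i)) * ∏ i, W (x i) (s i) (y i, z i) := by
    intro x y z
    simp only [avgChannel, ← Finset.prod_mul_distrib]
    exact (sum_prod_pi fun i s => q s * W (x i) s (y i, z i)).symm
  unfold PCode.errIID PCode.errGiven
  simp only [h, Finset.mul_sum]
  rw [Finset.sum_comm]
  refine Finset.sum_congr rfl fun m _ => ?_
  rw [Finset.sum_comm]
  refine Finset.sum_congr rfl fun y _ => ?_
  rw [Finset.sum_comm]
  refine Finset.sum_congr rfl fun z _ => ?_
  split_ifs
  · simp
  · rw [Finset.mul_sum]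
    exact Finset.sum_congr rfl fun s _ => by ring

omit [Fintype 𝒳] in
lemma errIID_mono {n M L : ℕ} (C : PCode 𝒳 𝒴 𝒴₁ n M L) {W : 𝒳 → 𝒮 → 𝒴 × 𝒴₁ → ℝ}
    (hW : IsChannel W) {q ν : 𝒮 → ℝ} (hq : ∀ s, 0 ≤ q s) (h : ∀ s, q s ≤ ν s) :
    C.errIID W q ≤ C.errIID W ν := by
  unfold PCode.errIID
  refine Finset.sum_le_sum fun s _ => mul_le_mul_of_nonneg_right
    (Finset.prod_le_prod (fun i _ => hq _) fun i _ => h _) ?_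
  refine mul_nonneg (by positivity) (Finset.sum_nonneg fun m _ => Finset.sum_nonneg fun y _ =>
    Finset.sum_nonneg fun z _ => ?_)
  split_ifs
  · exact le_rfl
  · exact Finset.prod_nonneg fun i _ => (hW _ _).1 _

open Classical in
lemma block_miss_le {υ : Type} [Fintype υ] {n : ℕ} {p : υ × 𝒳 → ℝ} {pU : υ → ℝ}
    {κ : υ → 𝒳 → ℝ} {V : 𝒳 → 𝒴 × 𝒴₁ → ℝ} {ρ : υ → 𝒳 → 𝒴 → 𝒴₁ → ℝ} {b t θ : ℝ}
    (hpκ : ∀ u x, p (u, x) = pU u * κ u x) (hpU : ∀ u, 0 ≤ pU u) (hκ : ∀ u x, 0 ≤ κ u x)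
    (hV : ∀ x z, 0 ≤ V x z) (hρ : ∀ u x y z, 0 < ρ u x y z) (hb : 0 < b) (ht : 0 ≤ t)
    (hθ : missMoment p V ρ b t ≤ θ)
    (T : (Fin n → υ) → (Fin n → 𝒳) → (Fin n → 𝒴) → (Fin n → 𝒴₁) → Prop)
    (hT : ∀ u x y z, b ^ n ≤ ∏ i, ρ (u i) (x i) (y i) (z i) → T u x y z) :
    ∑ u : Fin n → υ, ∑ x : Fin n → 𝒳, (∏ i, pU (u i)) * (∏ i, κ (u i) (x i)) *
      ∑ y : Fin n → 𝒴, ∑ z : Fin n → 𝒴₁, (∏ i, V (x i) (y i, z i)) *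
        (if T u x y z then 0 else 1) ≤ θ ^ n := by
  have hr : ∀ u x y z, 0 < b / ρ u x y z := fun u x y z => div_pos hb (hρ _ _ _ _)
  have hind : ∀ (u : Fin n → υ) (x : Fin n → 𝒳) (y : Fin n → 𝒴) (z : Fin n → 𝒴₁),
      (if T u x y z then (0 : ℝ) else 1) ≤ ∏ i, (b / ρ (u i) (x i) (y i) (z i)) ^ t := by
    intro u x y z
    split_ifs with h
    · exact Finset.prod_nonneg fun i _ => Real.rpow_nonneg (hr _ _ _ _).le _
    · have hlt : ∏ i, ρ (u i) (x i) (y i) (z i) < b ^ n := not_le.1 fun h' => h (hT u x y z h')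
      rw [Real.finsetProd_rpow _ _ fun i _ => (hr _ _ _ _).le]
      refine Real.one_le_rpow ?_ ht
      rw [Finset.prod_div_distrib, Finset.prod_const, Finset.card_univ, Fintype.card_fin,
        one_le_div (Finset.prod_pos fun i _ => hρ _ _ _ _)]
      exact hlt.le
  calc _ ≤ ∑ u : Fin n → υ, ∑ x : Fin n → 𝒳, (∏ i, pU (u i)) * (∏ i, κ (u i) (x i)) *
      ∑ y : Fin n → 𝒴, ∑ z : Fin n → 𝒴₁, (∏ i, V (x i) (y i, z i)) *
        ∏ i, (b / ρ (u i) (x i) (y i) (z i)) ^ t := by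
        refine Finset.sum_le_sum fun u _ => Finset.sum_le_sum fun x _ =>
          mul_le_mul_of_nonneg_left (Finset.sum_le_sum fun y _ => Finset.sum_le_sum fun z _ =>
          mul_le_mul_of_nonneg_left (hind u x y z) (Finset.prod_nonneg fun i _ => hV _ _))
          (mul_nonneg (Finset.prod_nonneg fun i _ => hpU _) (Finset.prod_nonneg fun i _ => hκ _ _))
    _ = missMoment p V ρ b t ^ n := by
        have e : ∀ (u : Fin n → υ) (x : Fin n → 𝒳),
            (∏ i, pU (u i)) * (∏ i, κ (u i) (x i)) *
              ∑ y : Fin n → 𝒴, ∑ z : Fin n → 𝒴₁, (∏ i, V (x i) (y i, z i)) *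
                ∏ i, (b / ρ (u i) (x i) (y i) (z i)) ^ t
            = ∏ i, ∑ y, ∑ z, p (u i, x i) * V (x i) (y, z) *
                (b / ρ (u i) (x i) y z) ^ t := by
          intro u x
          have h1 : ∀ y : Fin n → 𝒴, ∑ z : Fin n → 𝒴₁, (∏ i, V (x i) (y i, z i)) *
              ∏ i, (b / ρ (u i) (x i) (y i) (z i)) ^ t
              = ∏ i, ∑ z, V (x i) (y i, z) * (b / ρ (u i) (x i) (y i) z) ^ t := by
            intro y
            simp only [← Finset.prod_mul_distrib]
            exact sum_prod_pi fun i z => V (x i) (y i, z) * (b / ρ (u i) (x i) (y i) z) ^ t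
          simp only [h1]
          rw [sum_prod_pi fun i y => ∑ z, V (x i) (y, z) * (b / ρ (u i) (x i) y z) ^ t,
            ← Finset.prod_mul_distrib, ← Finset.prod_mul_distrib]
          refine Finset.prod_congr rfl fun i _ => ?_
          simp only [hpκ, Finset.mul_sum, mul_assoc]
        simp only [e]
        have h2 : ∀ u : Fin n → υ, ∑ x : Fin n → 𝒳, ∏ i, ∑ y, ∑ z, p (u i, x i) *
            V (x i) (y, z) * (b / ρ (u i) (x i) y z) ^ t = ∏ i, ∑ x, ∑ y, ∑ z, p (u i, x) *
            V x (y, z) * (b / ρ (u i) x y z) ^ t := fun u =>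
          sum_prod_pi fun i x => ∑ y, ∑ z, p (u i, x) * V x (y, z) * (b / ρ (u i) x y z) ^ t
        simp only [h2]
        rw [sum_prod_pi fun (_ : Fin n) u => ∑ x, ∑ y, ∑ z, p (u, x) * V x (y, z) *
          (b / ρ u x y z) ^ t]
        simp [missMoment]
    _ ≤ θ ^ n := by
        refine pow_le_pow_left₀ ?_ hθ n
        unfold missMoment
        refine Finset.sum_nonneg fun u _ => Finset.sum_nonneg fun x _ => Finset.sum_nonneg
          fun y _ => Finset.sum_nonneg fun z _ => mul_nonneg (mul_nonneg ?_ (hV _ _))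
            (Real.rpow_nonneg (hr _ _ _ _).le _)
        rw [hpκ]
        exact mul_nonneg (hpU _) (hκ _ _)

open Classical in
lemma block_false_le {α J : Type} [Fintype α] [Fintype J] {n : ℕ} {w : Fin n → α → ℝ}
    {r : J → Fin n → α → ℝ} (hw : ∀ i a, 0 ≤ w i a) (hr : ∀ j i a, 0 ≤ r j i a)
    (h : ∀ j i, ∑ a, w i a * r j i a ≤ 1) {B : ℝ} (hB : 0 < B) (T : (Fin n → α) → Prop)
    (hT : ∀ a, T a → ∃ j, B ≤ ∏ i, r j i (a i)) :
    ∑ a : Fin n → α, (∏ i, w i (a i)) * (if T a then 1 else 0)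
      ≤ Fintype.card J / B := by
  have hr' : ∀ j (a : Fin n → α), 0 ≤ ∏ i, r j i (a i) := fun j a =>
    Finset.prod_nonneg fun i _ => hr _ _ _
  have hind : ∀ a : Fin n → α, (if T a then (1 : ℝ) else 0)
      ≤ ∑ j, (∏ i, r j i (a i)) / B := by
    intro a
    split_ifs with ha
    · obtain ⟨j, hj⟩ := hT a ha
      exact ((one_le_div hB).2 hj).trans (Finset.single_le_sum
        (f := fun j => (∏ i, r j i (a i)) / B) (fun j _ => div_nonneg (hr' j a) hB.le)
        (Finset.mem_univ j))
    · exact Finset.sum_nonneg fun j _ => div_nonneg (hr' j a) hB.le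
  calc _ ≤ ∑ a : Fin n → α, (∏ i, w i (a i)) * ∑ j, (∏ i, r j i (a i)) / B :=
        Finset.sum_le_sum fun a _ => mul_le_mul_of_nonneg_left (hind a)
          (Finset.prod_nonneg fun i _ => hw _ _)
    _ = ∑ j, (∏ i, ∑ a, w i a * r j i a) / B := by
        simp only [Finset.mul_sum]
        rw [Finset.sum_comm]
        refine Finset.sum_congr rfl fun j _ => ?_
        rw [← sum_prod_pi fun i a => w i a * r j i a, Finset.sum_div]
        refine Finset.sum_congr rfl fun a _ => ?_
        rw [Finset.prod_mul_distrib, mul_div_assoc]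
    _ ≤ ∑ _j : J, 1 / B := by
        refine Finset.sum_le_sum fun j _ => div_le_div_of_nonneg_right ?_ hB.le
        exact Finset.prod_le_one (fun i _ => Finset.sum_nonneg fun a _ =>
          mul_nonneg (hw _ _) (hr _ _ _)) fun i _ => h j i
    _ = Fintype.card J / B := by simp [div_eq_mul_inv]

lemma isPMF_prod {α : Type} [Fintype α] {n : ℕ} {w : Fin n → α → ℝ} (hw : ∀ i, IsPMF (w i)) :
    IsPMF fun a : Fin n → α => ∏ i, w i (a i) :=
  ⟨fun a => Finset.prod_nonneg fun i _ => (hw i).1 _, by rw [sum_prod_pi]; simp [(hw _).2]⟩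

omit [Fintype 𝒳] in
lemma sum_prod_avgChannel {W : 𝒳 → 𝒮 → 𝒴 × 𝒴₁ → ℝ} (hW : IsChannel W) (q : 𝒮 → ℝ) {n : ℕ}
    (x : Fin n → 𝒳) :
    ∑ y : Fin n → 𝒴, ∑ z : Fin n → 𝒴₁, ∏ i, avgChannel W q (x i) (y i, z i)
      = (∑ s, q s) ^ n := by
  have h1 : ∀ y : Fin n → 𝒴, ∑ z : Fin n → 𝒴₁, ∏ i, avgChannel W q (x i) (y i, z i)
      = ∏ i, ∑ z, avgChannel W q (x i) (y i, z) := fun y =>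
    sum_prod_pi fun i z => avgChannel W q (x i) (y i, z)
  have h2 : ∀ i, ∑ y, ∑ z, avgChannel W q (x i) (y, z) = ∑ s, q s := fun i => by
    rw [← Fintype.sum_prod_type, sum_avgChannel hW]
  simp only [h1]
  rw [sum_prod_pi fun i y => ∑ z, avgChannel W q (x i) (y, z)]
  simp [h2]

lemma exists_block_code {υ J : Type} [Fintype υ] [Fintype J] {p : υ × 𝒳 → ℝ} {pU : υ → ℝ}
    {κ : υ → 𝒳 → ℝ} (hpκ : ∀ u x, p (u, x) = pU u * κ u x) (hpU : IsPMF pU)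
    (hκ : ∀ u, IsPMF (κ u)) {W : 𝒳 → 𝒮 → 𝒴 × 𝒴₁ → ℝ} (hW : IsChannel W) {ν : J → 𝒮 → ℝ}
    (hν : ∀ j s, 0 ≤ ν j s) {μ : ℝ} (hμ0 : 0 ≤ μ) (hμ : ∀ j, ∑ s, ν j s ≤ μ)
    (τ : J → ScoreTriple 𝒴 𝒴₁ pU κ) {b₁ b₂ b₃ θ : ℝ} (hb₁ : 0 < b₁) (hb₂ : 0 < b₂) (hb₃ : 0 < b₃)
    (hτ : ∀ j, (τ j).MissLE p (avgChannel W (ν j)) b₁ b₂ b₃ θ)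
    (n : ℕ) {M' M'' L : ℕ} (hM' : 0 < M') (hM'' : 0 < M'') (hL : 0 < L) :
    ∃ C : PCode 𝒳 𝒴 𝒴₁ n (M' * M'') L, ∀ j, C.errIID W (ν j) ≤
      Fintype.card J * (3 * θ ^ n + μ ^ n * ((M' - 1) * (Fintype.card J / b₁ ^ n)
        + (M' - 1) / L * (Fintype.card J / b₂ ^ n) + (M'' - 1) * (Fintype.card J / b₃ ^ n))) := by
  have hV : ∀ j x z, 0 ≤ avgChannel W (ν j) x z := fun j x z => avgChannel_nonneg hW (hν j) x z
  set T₁ : (Fin n → υ) → (Fin n → 𝒴₁) → Prop :=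
    fun u z => ∃ j, b₁ ^ n ≤ ∏ i, (τ j).relay (u i) (z i) with hT₁
  set T₂ : (Fin n → υ) → (Fin n → 𝒴) → Prop :=
    fun u y => ∃ j, b₂ ^ n ≤ ∏ i, (τ j).cloud (u i) (y i) with hT₂
  set T₃ : (Fin n → υ) → (Fin n → 𝒳) → (Fin n → 𝒴) → Prop :=
    fun u x y => ∃ j, b₃ ^ n ≤ ∏ i, (τ j).satellite (u i) (x i) (y i) with hT₃
  have miss₁ := fun j => block_miss_le (n := n) hpκ hpU.1 (fun u => (hκ u).1) (hV j)
    (fun u _ _ z => (τ j).relay_pos u z) hb₁ (τ j).relayExp_nonneg (hτ j).1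
    (fun u _ _ z => T₁ u z) fun _ _ _ _ h => ⟨j, h⟩
  have miss₂ := fun j => block_miss_le (n := n) hpκ hpU.1 (fun u => (hκ u).1) (hV j)
    (fun u _ y _ => (τ j).cloud_pos u y) hb₂ (τ j).cloudExp_nonneg (hτ j).2.1
    (fun u _ y _ => T₂ u y) fun _ _ _ _ h => ⟨j, h⟩
  have miss₃ := fun j => block_miss_le (n := n) hpκ hpU.1 (fun u => (hκ u).1) (hV j)
    (fun u x y _ => (τ j).satellite_pos u x y) hb₃ (τ j).satelliteExp_nonneg (hτ j).2.2
    (fun u x y _ => T₃ u x y) fun _ _ _ _ h => ⟨j, h⟩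
  have false₁ := fun z : Fin n → 𝒴₁ => block_false_le (w := fun _ => pU)
    (r := fun j i u => (τ j).relay u (z i)) (fun _ => hpU.1)
    (fun j i u => ((τ j).relay_pos _ _).le) (fun j i => (τ j).relay_mean _) (pow_pos hb₁ n)
    (fun u => T₁ u z) fun u h => h
  have false₂ := fun y : Fin n → 𝒴 => block_false_le (w := fun _ => pU)
    (r := fun j i u => (τ j).cloud u (y i)) (fun _ => hpU.1)
    (fun j i u => ((τ j).cloud_pos _ _).le) (fun j i => (τ j).cloud_mean _) (pow_pos hb₂ n)
    (fun u => T₂ u y) fun u h => h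
  have false₃ := fun (u : Fin n → υ) (y : Fin n → 𝒴) => block_false_le (w := fun i => κ (u i))
    (r := fun j i x => (τ j).satellite (u i) x (y i)) (fun i => (hκ _).1)
    (fun j i x => ((τ j).satellite_pos _ _ _).le) (fun j i => (τ j).satellite_mean _ _)
    (pow_pos hb₃ n) (fun x => T₃ u x y) fun x h => h
  clear_value T₁ T₂ T₃
  have hmass : ∀ j (x : Fin n → 𝒳), ∑ y : Fin n → 𝒴, ∑ z : Fin n → 𝒴₁,
      ∏ i, avgChannel W (ν j) (x i) (y i, z i) ≤ μ ^ n := fun j x => by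
    rw [sum_prod_avgChannel hW]
    exact pow_le_pow_left₀ (Finset.sum_nonneg fun s _ => hν j s) (hμ j) n
  obtain ⟨f, f₁, g, hfg⟩ := exists_oneShot_code (J := J)
    (P := fun u : Fin n → υ => ∏ i, pU (u i))
    (K := fun u (x : Fin n → 𝒳) => ∏ i, κ (u i) (x i))
    (isPMF_prod fun _ => hpU) (fun u => isPMF_prod fun i => hκ (u i))
    (G := fun j x (y : Fin n → 𝒴) (z : Fin n → 𝒴₁) => ∏ i, avgChannel W (ν j) (x i) (y i, z i))
    (fun j x y z => Finset.prod_nonneg fun i _ => hV _ _ _) hmass T₁ T₂ T₃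
    (by positivity) (by positivity) (by positivity) (by positivity)
    miss₁ miss₂ miss₃ false₁ false₂ false₃ hM' hM'' hL
  refine ⟨⟨fun m => f (finProdFinEquiv.symm m), f₁, fun yl => finProdFinEquiv (g yl)⟩,
    fun j => ?_⟩
  rw [errIID_eq, ← finProdFinEquiv.sum_comp]
  have hM0 : (0 : ℝ) < M' * M'' := by positivity
  push_cast
  rw [inv_mul_le_iff₀ hM0]
  simpa only [Equiv.symm_apply_apply, EmbeddingLike.apply_eq_iff_eq] using hfg j

end Block

section Rates

variable {𝒳 𝒮 𝒴 𝒴₁ : Type} [Fintype 𝒳] [Fintype 𝒮] [Fintype 𝒴] [Fintype 𝒴₁]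

lemma exists_disintegration {υ : Type} [Nonempty 𝒳] {p : υ × 𝒳 → ℝ} (hp : ∀ a, 0 ≤ p a) :
    ∃ κ : υ → 𝒳 → ℝ, (∀ u, IsPMF (κ u)) ∧ ∀ u x, p (u, x) = (∑ x', p (u, x')) * κ u x := by
  classical
  obtain ⟨x₀⟩ := ‹Nonempty 𝒳›
  have key : ∀ u, ∃ w : 𝒳 → ℝ, IsPMF w ∧ ∀ x, p (u, x) = (∑ x', p (u, x')) * w x := by
    intro u
    by_cases h : ∑ x', p (u, x') = 0
    · refine ⟨fun x => if x = x₀ then 1 else 0, ⟨fun x => by dsimp only; split_ifs <;> norm_num, by simp⟩,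
        fun x => ?_⟩
      rw [h, zero_mul]
      exact (Finset.sum_eq_zero_iff_of_nonneg fun x _ => hp (u, x)).1 h x (Finset.mem_univ x)
    · refine ⟨fun x => p (u, x) / ∑ x', p (u, x'), ⟨fun x => div_nonneg (hp _)
        (Finset.sum_nonneg fun x _ => hp _), by rw [← Finset.sum_div, div_self h]⟩, fun x => ?_⟩
      rw [mul_div_cancel₀ _ h]
  choose κ h₁ h₂ using key
  exact ⟨κ, h₁, h₂⟩

lemma exists_exp_bound {r K : ℝ} (hr0 : 0 < r) (hr1 : r < 1) :
    ∃ a > (0 : ℝ), ∃ n₀ : ℕ, ∀ n : ℕ, n₀ ≤ n → K * r ^ n ≤ Real.exp (-(a * n)) := by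
  have ha : 0 < -Real.log r / 2 := by linarith [Real.log_neg hr0 hr1]
  set a := -Real.log r / 2 with ha_def
  have hs1 : Real.exp (-a) < 1 := by rw [Real.exp_lt_one_iff]; linarith
  have hsr : Real.exp (-a) * Real.exp (-a) = r := by
    rw [← Real.exp_add, show -a + -a = Real.log r by rw [ha_def]; ring, Real.exp_log hr0]
  have hlim : Filter.Tendsto (fun n : ℕ => K * Real.exp (-a) ^ n) Filter.atTop (nhds (K * 0)) :=
    (tendsto_pow_atTop_nhds_zero_of_lt_one (Real.exp_pos _).le hs1).const_mul K
  rw [mul_zero] at hlim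
  obtain ⟨n₀, hn₀⟩ := Filter.eventually_atTop.1 (hlim.eventually_le_const one_pos)
  refine ⟨a, ha, n₀, fun n hn => ?_⟩
  have he : Real.exp (-(a * n)) = Real.exp (-a) ^ n := by
    rw [← Real.exp_nat_mul]; congr 1; ring
  rw [he, ← hsr, mul_pow, ← mul_assoc]
  exact mul_le_of_le_one_left (by positivity) (hn₀ n hn)

/-- If the relay, cloud and satellite rates are all below the respective information
quantities by a margin `d`, uniformly over the closure of the state set, then the rate
`R' + R''` is achieved with exponentially decaying error. -/
lemma exists_codes_of_rates_lt [Nonempty 𝒳] {k : ℕ} {p : Fin k × 𝒳 → ℝ} (hp : IsPMF p)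
    {W : 𝒳 → 𝒮 → 𝒴 × 𝒴₁ → ℝ} (hW : IsChannel W) {C1 : ℝ} (hC1 : 0 ≤ C1)
    {Q : Set (𝒮 → ℝ)} (hQ : ∀ q ∈ Q, IsPMF q) {R' R'' d : ℝ} (hd : 0 < d)
    (h₁ : ∀ q ∈ closure Q, R' + d < IqUY1 W p q)
    (h₂ : ∀ q ∈ closure Q, R' - C1 + d < IqUY W p q)
    (h₃ : ∀ q ∈ closure Q, R'' + d < IqXYgivenU W p q) :
    ∃ a > (0 : ℝ), ∃ n₀ : ℕ, ∀ n ≥ n₀, ∃ (M L : ℕ) (C : PCode 𝒳 𝒴 𝒴₁ n M L),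
      (2 : ℝ) ^ ((n : ℝ) * (R' + R'')) ≤ (M : ℝ) ∧ LinkOK n L C1 ∧
      ∀ q ∈ Q, C.errIID W q ≤ Real.exp (-(a * n)) := by
  obtain ⟨κ, hκ, hpκ⟩ := exists_disintegration hp.1
  have hpU : IsPMF fun u => ∑ x, p (u, x) :=
    ⟨fun u => Finset.sum_nonneg fun x _ => hp.1 _, by rw [← Fintype.sum_prod_type, hp.2]⟩
  have hμ : (1 : ℝ) < 2 ^ (d / 2) := Real.one_lt_rpow one_lt_two (by linarith)
  obtain ⟨J, _, ν, τ, θ, hθ0, hθ1, hν0, hνμ, hcov, hτ⟩ :=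
    exists_score_cover hp (fun _ => rfl) hκ hpκ hW hQ hμ h₁ h₂ h₃
  set ρ : ℝ := 2 ^ (-(d / 2)) with hρ
  have hρ0 : 0 < ρ := by positivity
  have hρ1 : ρ < 1 := Real.rpow_lt_one_of_one_lt_of_neg one_lt_two (by linarith)
  set c : ℝ := (Fintype.card J : ℝ) with hc
  have hc0 : 0 ≤ c := by positivity
  obtain ⟨a, ha, n₀, hn₀⟩ := exists_exp_bound (K := c * (3 + 4 * c))
    (lt_max_of_lt_right hρ0) (max_lt hθ1 hρ1)
  refine ⟨a, ha, n₀, fun n hn => ?_⟩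
  have hP : ∀ y : ℝ, ((2 : ℝ) ^ y) ^ n = 2 ^ ((n : ℝ) * y) := fun y => by
    rw [← Real.rpow_natCast, ← Real.rpow_mul zero_le_two, mul_comm]
  have hpos : ∀ y : ℝ, (0 : ℝ) < 2 ^ y := fun y => by positivity
  have hL1 : (1 : ℝ) ≤ 2 ^ ((n : ℝ) * C1) := Real.one_le_rpow one_le_two (by positivity)
  obtain ⟨C, hC⟩ := exists_block_code hpκ hpU hκ hW hν0 (by positivity) hνμ τ (hpos _) (hpos _)
    (hpos _) hτ n (Nat.ceil_pos.2 (hpos ((n : ℝ) * R'))) (Nat.ceil_pos.2 (hpos ((n : ℝ) * R'')))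
    (Nat.floor_pos.2 hL1)
  have hceil : ∀ y : ℝ, ((⌈(2 : ℝ) ^ y⌉₊ : ℕ) : ℝ) - 1 ≤ 2 ^ y := fun y => by
    linarith [Nat.ceil_lt_add_one (hpos y).le]
  have hfloor : (⌊(2 : ℝ) ^ ((n : ℝ) * C1)⌋₊ : ℝ) ≥ 2 ^ ((n : ℝ) * C1) / 2 := by
    have h1 := Nat.lt_floor_add_one ((2 : ℝ) ^ ((n : ℝ) * C1))
    have h2 : (1 : ℝ) ≤ ⌊(2 : ℝ) ^ ((n : ℝ) * C1)⌋₊ := by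
      exact_mod_cast Nat.floor_pos.2 hL1
    linarith
  refine ⟨_, _, C, ?_, ⟨Nat.floor_pos.2 hL1, Nat.floor_le (hpos _).le⟩, fun q hq => ?_⟩
  · rw [mul_add, Real.rpow_add two_pos]
    push_cast
    exact mul_le_mul (Nat.le_ceil _) (Nat.le_ceil _) (hpos _).le (by positivity)
  obtain ⟨j, hj⟩ := hcov q hq
  refine (errIID_mono C hW (hQ q hq).1 hj).trans ((hC j).trans (le_trans ?_ (hn₀ n hn)))
  simp only [hP, ← hc]
  have e1 : ((⌈(2 : ℝ) ^ ((n : ℝ) * R')⌉₊ : ℝ) - 1) * (c / 2 ^ ((n : ℝ) * (R' + d)))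
      ≤ c * 2 ^ (-((n : ℝ) * d)) := by
    refine (mul_le_mul_of_nonneg_right (hceil _) (by positivity)).trans_eq ?_
    rw [mul_div_left_comm, ← Real.rpow_sub two_pos]
    congr 2; ring
  have e3 : ((⌈(2 : ℝ) ^ ((n : ℝ) * R'')⌉₊ : ℝ) - 1) * (c / 2 ^ ((n : ℝ) * (R'' + d)))
      ≤ c * 2 ^ (-((n : ℝ) * d)) := by
    refine (mul_le_mul_of_nonneg_right (hceil _) (by positivity)).trans_eq ?_
    rw [mul_div_left_comm, ← Real.rpow_sub two_pos]
    congr 2; ring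
  have e2 : ((⌈(2 : ℝ) ^ ((n : ℝ) * R')⌉₊ : ℝ) - 1) / ⌊(2 : ℝ) ^ ((n : ℝ) * C1)⌋₊ *
      (c / 2 ^ ((n : ℝ) * (R' - C1 + d))) ≤ 2 * c * 2 ^ (-((n : ℝ) * d)) := by
    have : ((⌈(2 : ℝ) ^ ((n : ℝ) * R')⌉₊ : ℝ) - 1) / ⌊(2 : ℝ) ^ ((n : ℝ) * C1)⌋₊
        ≤ 2 ^ ((n : ℝ) * R') / (2 ^ ((n : ℝ) * C1) / 2) :=
      div_le_div₀ (hpos _).le (hceil _) (by positivity) hfloor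
    refine (mul_le_mul_of_nonneg_right this (by positivity)).trans_eq ?_
    rw [show -((n : ℝ) * d) = n * R' - n * C1 - n * (R' - C1 + d) by ring,
      Real.rpow_sub two_pos, Real.rpow_sub two_pos]
    field_simp
  have hprod : (2 : ℝ) ^ ((n : ℝ) * (d / 2)) * 2 ^ (-((n : ℝ) * d)) = ρ ^ n := by
    rw [hρ, hP, ← Real.rpow_add two_pos]
    congr 1; ring
  calc _ ≤ c * (3 * θ ^ n + 2 ^ ((n : ℝ) * (d / 2)) * (c * 2 ^ (-((n : ℝ) * d))
        + 2 * c * 2 ^ (-((n : ℝ) * d)) + c * 2 ^ (-((n : ℝ) * d)))) := by gcongr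
    _ = c * (3 * θ ^ n + 4 * c * ρ ^ n) := by rw [← hprod]; ring
    _ ≤ c * (3 * max θ ρ ^ n + 4 * c * max θ ρ ^ n) := by
        gcongr
        · exact le_max_left _ _
        · exact le_max_right _ _
    _ = c * (3 + 4 * c) * max θ ρ ^ n := by ring

lemma sInf_le_of_mem_closure {Q : Set (𝒮 → ℝ)} (hQ : ∀ q ∈ Q, IsPMF q) {F : (𝒮 → ℝ) → ℝ}
    (hF : Continuous F) {q : 𝒮 → ℝ} (hq : q ∈ closure Q) : sInf {v | ∃ q ∈ Q, v = F q} ≤ F q := by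
  have hbdd : BddBelow {v | ∃ q ∈ Q, v = F q} := by
    refine ((isCompact_closure_of_isPMF hQ).bddBelow_image hF.continuousOn).mono ?_
    rintro _ ⟨q, hq, rfl⟩
    exact ⟨q, subset_closure hq, rfl⟩
  have hsub : closure Q ⊆ {q | sInf {v | ∃ q ∈ Q, v = F q} ≤ F q} :=
    closure_minimal (fun q hq => csInf_le hbdd ⟨q, hq, rfl⟩) (isClosed_le continuous_const hF)
  exact hsub hq

lemma exists_codes_of_lt_RDF [Nonempty 𝒳] {W : 𝒳 → 𝒮 → 𝒴 × 𝒴₁ → ℝ} (hW : IsChannel W)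
    {C1 : ℝ} (hC1 : 0 ≤ C1) {Q : Set (𝒮 → ℝ)} (hQ : ∀ q ∈ Q, IsPMF q) {R : ℝ}
    (hR : R < RDF W C1 Q) :
    ∃ a > (0 : ℝ), ∃ n₀ : ℕ, ∀ n ≥ n₀, ∃ (M L : ℕ) (C : PCode 𝒳 𝒴 𝒴₁ n M L),
      (2 : ℝ) ^ ((n : ℝ) * R) ≤ (M : ℝ) ∧ LinkOK n L C1 ∧
      ∀ q ∈ Q, C.errIID W q ≤ Real.exp (-(a * n)) := by
  classical
  obtain ⟨x₀⟩ := id ‹Nonempty 𝒳›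
  obtain ⟨_, ⟨k, p, hp, rfl⟩, hlt⟩ := exists_lt_of_lt_csSup (by
    refine ⟨_, 1, fun a => if a = (0, x₀) then 1 else 0,
      ⟨fun a => by dsimp only; split_ifs <;> norm_num, by simp⟩, rfl⟩) hR
  obtain ⟨hY, hY1⟩ := lt_min_iff.1 hlt
  set A := sInf {v | ∃ q ∈ Q, v = IqUY W p q} with hA
  set A₁ := sInf {v | ∃ q ∈ Q, v = IqUY1 W p q} with hA₁
  set B := sInf {v | ∃ q ∈ Q, v = IqXYgivenU W p q} with hB
  set D := min (A + C1) A₁ with hD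
  have hDA : D ≤ A + C1 := min_le_left _ _
  have hDA₁ : D ≤ A₁ := min_le_right _ _
  have hDR : R < D + B := by
    rcases min_choice (A + C1) A₁ with h | h <;> rw [hD, h] <;> linarith
  have hd : 0 < (D + B - R) / 4 := by linarith
  have := exists_codes_of_rates_lt hp hW hC1 hQ (R' := D - (D + B - R) / 2)
    (R'' := B - (D + B - R) / 2) hd
    (fun q hq => by
      have : A₁ ≤ _ := sInf_le_of_mem_closure hQ (continuous_IqUY1 W p) hq
      linarith)
    (fun q hq => by
      have : A ≤ _ := sInf_le_of_mem_closure hQ (continuous_IqUY W p) hq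
      linarith)
    (fun q hq => by
      have : B ≤ _ := sInf_le_of_mem_closure hQ (continuous_IqXYgivenU W p) hq
      linarith)
  rwa [show D - (D + B - R) / 2 + (B - (D + B - R) / 2) = R by ring] at this

omit [Fintype 𝒳] in
/-- Counting bound on the success probability of an arbitrary code. -/
lemma one_sub_errIID_le {n M L : ℕ} (hM : 0 < M) (C : PCode 𝒳 𝒴 𝒴₁ n M L)
    {W : 𝒳 → 𝒮 → 𝒴 × 𝒴₁ → ℝ} (hW : IsChannel W) {q : 𝒮 → ℝ} (hq : IsPMF q) :
    1 - C.errIID W q ≤ (M : ℝ)⁻¹ * ((Fintype.card 𝒴 : ℝ) ^ n * L) := by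
  classical
  have hV : ∀ x z, 0 ≤ avgChannel W q x z := fun x z => avgChannel_nonneg hW hq.1 x z
  set G : (Fin n → 𝒳) → (Fin n → 𝒴) → (Fin n → 𝒴₁) → ℝ :=
    fun x y z => ∏ i, avgChannel W q (x i) (y i, z i) with hG
  have hG0 : ∀ x y z, 0 ≤ G x y z := fun x y z => Finset.prod_nonneg fun i _ => hV _ _
  have hmass : ∀ x, ∑ y, ∑ z, G x y z = 1 := by
    intro x
    rw [hG, sum_prod_avgChannel hW, hq.2, one_pow]
  have hle1 : ∀ x (s : Finset (Fin n → 𝒴₁)) y, ∑ z ∈ s, G x y z ≤ 1 := by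
    intro x s y
    calc _ ≤ ∑ z, G x y z :=
          Finset.sum_le_sum_of_subset_of_nonneg (Finset.subset_univ s) fun z _ _ => hG0 _ _ _
      _ ≤ ∑ y, ∑ z, G x y z := Finset.single_le_sum (f := fun y => ∑ z, G x y z)
          (fun y _ => Finset.sum_nonneg fun z _ => hG0 _ _ _) (Finset.mem_univ y)
      _ = 1 := hmass x
  have hM0 : (0 : ℝ) < M := by exact_mod_cast hM
  have hsplit : 1 - C.errIID W q = (M : ℝ)⁻¹ * ∑ m : Fin M, ∑ y, ∑ z,
      if C.g (y, C.f1 z) = m then G (C.f m) y z else 0 := by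
    have h1 : (1 : ℝ) = (M : ℝ)⁻¹ * ∑ m : Fin M, ∑ y, ∑ z, G (C.f m) y z := by
      simp only [hmass]
      simp [hM0.ne']
    rw [errIID_eq]
    conv_lhs => rw [h1]
    rw [← mul_sub, ← Finset.sum_sub_distrib]
    simp only [← Finset.sum_sub_distrib]
    congr 1
    refine Finset.sum_congr rfl fun m _ => Finset.sum_congr rfl fun y _ =>
      Finset.sum_congr rfl fun z _ => ?_
    split_ifs <;> simp [hG]
  rw [hsplit]
  refine mul_le_mul_of_nonneg_left ?_ (by positivity)
  have hfib : ∀ m y, ∑ z, (if C.g (y, C.f1 z) = m then G (C.f m) y z else 0)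
      ≤ ∑ l : Fin L, if C.g (y, l) = m then 1 else 0 := by
    intro m y
    rw [← Finset.sum_fiberwise Finset.univ C.f1]
    refine Finset.sum_le_sum fun l _ => ?_
    calc _ = ∑ z with C.f1 z = l, if C.g (y, l) = m then G (C.f m) y z else 0 :=
          Finset.sum_congr rfl fun z hz => by rw [(Finset.mem_filter.1 hz).2]
      _ ≤ _ := by
          split_ifs
          · exact hle1 _ _ _
          · simp
  calc _ ≤ ∑ m : Fin M, ∑ y : Fin n → 𝒴, ∑ l : Fin L, (if C.g (y, l) = m then (1 : ℝ) else 0) :=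
        Finset.sum_le_sum fun m _ => Finset.sum_le_sum fun y _ => hfib m y
    _ = ∑ y : Fin n → 𝒴, ∑ l : Fin L, ∑ m : Fin M, (if C.g (y, l) = m then (1 : ℝ) else 0) := by
        rw [Finset.sum_comm]
        exact Finset.sum_congr rfl fun y _ => Finset.sum_comm
    _ = (Fintype.card 𝒴 : ℝ) ^ n * L := by simp

omit [Fintype 𝒳] in
lemma bddAbove_compAchievable {W : 𝒳 → 𝒮 → 𝒴 × 𝒴₁ → ℝ} (hW : IsChannel W) (C1 : ℝ)
    {Q : Set (𝒮 → ℝ)} (hQ : ∀ q ∈ Q, IsPMF q) (hQne : Q.Nonempty) :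
    BddAbove {R | CompAchievable W C1 Q R} := by
  obtain ⟨q, hq⟩ := hQne
  refine ⟨1 + Real.logb 2 (Fintype.card 𝒴 + 1) + C1, fun R hR => ?_⟩
  obtain ⟨N, hN⟩ := hR (1 / 2) (by norm_num)
  obtain ⟨n, hn⟩ : ∃ n, n = N + 1 := ⟨_, rfl⟩
  obtain ⟨M, L, C, hM, hL, hC⟩ := hN n (by omega)
  have hM0 : (0 : ℝ) < M := lt_of_lt_of_le (by positivity) hM
  have h1 := one_sub_errIID_le (by exact_mod_cast hM0) C hW (hQ q hq)
  have h2 := hC q hq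
  have h3 : (1 / 2 : ℝ) ≤ (M : ℝ)⁻¹ * ((Fintype.card 𝒴 : ℝ) ^ n * L) := by linarith
  rw [le_inv_mul_iff₀ hM0] at h3
  set K : ℝ := Fintype.card 𝒴 + 1 with hK
  have hK0 : 0 < K := by positivity
  have hn1 : (1 : ℝ) ≤ n := by rw [hn]; push_cast; linarith [Nat.cast_nonneg (α := ℝ) N]
  have h4 : (2 : ℝ) ^ ((n : ℝ) * R) ≤ 2 ^ ((n : ℝ) * (1 + Real.logb 2 K + C1)) := by
    calc (2 : ℝ) ^ ((n : ℝ) * R) ≤ 2 * ((Fintype.card 𝒴 : ℝ) ^ n * L) := by linarith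
      _ ≤ 2 ^ (n : ℝ) * (K ^ n * 2 ^ ((n : ℝ) * C1)) := by
          gcongr
          · calc (2 : ℝ) = 2 ^ (1 : ℝ) := (Real.rpow_one 2).symm
              _ ≤ _ := Real.rpow_le_rpow_of_exponent_le one_le_two hn1
          · rw [hK]; linarith
          · exact hL.2
      _ = _ := by
          rw [mul_add, mul_add, Real.rpow_add two_pos, Real.rpow_add two_pos, mul_one, mul_assoc,
            mul_comm (n : ℝ) (Real.logb 2 K), Real.rpow_mul zero_le_two (Real.logb 2 K),
            Real.rpow_logb two_pos (by norm_num) hK0, Real.rpow_natCast K]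
  rw [Real.rpow_le_rpow_left_iff one_lt_two] at h4
  exact le_of_mul_le_mul_left h4 (by linarith)

end Rates

/-- Partial decode-forward achievability for the compound primitive relay channel:
any rate below `R_DF(Q)` is achievable with exponentially decaying error, and hence
the deterministic code capacity is at least `R_DF(Q)`. -/
theorem compound_partialDecodeForward
    {𝒳 𝒮 𝒴 𝒴₁ : Type} [Fintype 𝒳] [Fintype 𝒮] [Fintype 𝒴] [Fintype 𝒴₁] [Nonempty 𝒳]
    (W : 𝒳 → 𝒮 → 𝒴 × 𝒴₁ → ℝ) (hW : IsChannel W)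
    (C1 : ℝ) (hC1 : 0 ≤ C1)
    (Q : Set (𝒮 → ℝ)) (hQ : ∀ q ∈ Q, IsPMF q) (hQne : Q.Nonempty) :
    (∀ R : ℝ, R < RDF W C1 Q →
      ∃ a > (0 : ℝ), ∃ n₀ : ℕ, ∀ n ≥ n₀, ∃ (M L : ℕ) (C : PCode 𝒳 𝒴 𝒴₁ n M L),
        (2 : ℝ) ^ ((n : ℝ) * R) ≤ (M : ℝ) ∧ LinkOK n L C1 ∧
        ∀ q ∈ Q, C.errIID W q ≤ Real.exp (-(a * n))) ∧
    RDF W C1 Q ≤ CompCapacity W C1 Q := by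
  have key := fun R (hR : R < RDF W C1 Q) => exists_codes_of_lt_RDF hW hC1 hQ hR
  refine ⟨key, le_of_forall_lt fun R hR => ?_⟩
  obtain ⟨R', hRR', hR'⟩ := exists_between hR
  refine hRR'.trans_le (le_csSup (bddAbove_compAchievable hW C1 hQ hQne) fun ε hε => ?_)
  obtain ⟨a, ha, n₀, h⟩ := key R' hR'
  have hlim : Filter.Tendsto (fun n : ℕ => Real.exp (-(a * n))) Filter.atTop (nhds 0) :=
    Real.tendsto_exp_neg_atTop_nhds_zero.comp
      (tendsto_natCast_atTop_atTop.const_mul_atTop ha)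
  obtain ⟨n₁, hn₁⟩ := Filter.eventually_atTop.1 (hlim.eventually_le_const hε)
  refine ⟨max n₀ n₁, fun n hn => ?_⟩
  obtain ⟨M, L, C, hM, hL, hC⟩ := h n (le_of_max_le_left hn)
  exact ⟨M, L, C, hM, hL, fun q hq => (hC q hq).trans (hn₁ n (le_of_max_le_right hn))⟩
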